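/- arXiv:math/0601471 — 2 statements merged into one kernel-verified Lean document; each statement's English description precedes it below -/
import Mathlib

section
/- The intermediate Wakimoto operators satisfy the Serre relations (R5) and (R6): for all 1 ≤ i, j ≤ n with (α_i|α_j) ≠ −1 (i.e. |i−j| ≠ 1) and all m, p ∈ ℤ, [ρ(E_i)_m, ρ(E_j)_p] = 0 and [ρ(F_i)_m, ρ(F_j)_p] = 0; and for all 1 ≤ i, j ≤ n with (α_i|α_j) = −1 (i.e. |i−j| = 1) and all m₁, m₂, p ∈ ℤ, [ρ(E_i)_{m₁}, [ρ(E_i)_{m₂}, ρ(E_j)_p]] = 0 and [ρ(F_i)_{m₁}, [ρ(F_i)_{m₂}, ρ(F_j)_p]] = 0, where (α_i|α_j) = (A_n)_{ij}. -/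
open MvPolynomial

/-- The Cartan matrix of `sl(n+1, ℂ)` in 1-based indices. -/
noncomputable def cartanEntry (i j : ℕ) : ℂ :=
  if i = j then 2 else if i + 1 = j ∨ j + 1 = i then -1 else 0

/-- The entries of the matrix `𝔅` (1-based indices). -/
noncomputable def Bentry (r : ℕ) (γ : ℂ) (i j : ℕ) : ℂ :=
  cartanEntry i j *
    (γ ^ 2 - (if r < i then 1 else 0) * (if r < j then 1 else 0) * ((r : ℂ) + 1)
      + ((r : ℂ) / 2) * (if i = r + 1 then 1 else 0) * (if j = r + 1 then 1 else 0))

/-- Index set for the variables `x_{ij,m}`, `1 ≤ i ≤ j ≤ n`, `m ∈ ℤ`. -/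
abbrev XIdx (n : ℕ) : Type := {v : ℕ × ℕ // 1 ≤ v.1 ∧ v.1 ≤ v.2 ∧ v.2 ≤ n} × ℤ

/-- Index set for the variables `y_{k,m}`, `1 ≤ k ≤ n` (encoded by `Fin n`,
`k ↦ k + 1`) and `m ≥ 1`. -/
abbrev YIdx (n : ℕ) : Type := Fin n × {m : ℕ // 1 ≤ m}

/-- The Fock space `F = ℂ[x_{ij,m}; y_{k,m}]`. -/
abbrev FSp (n : ℕ) : Type := MvPolynomial (XIdx n ⊕ YIdx n) ℂ

/-- The operator `a_{ij,m}`: it is `∂/∂x_{ij,m}` if `m ≥ 0` and `j ≤ r`, and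
multiplication by `x_{ij,m}` otherwise (and junk `0` for invalid indices `i, j`,
which are never used).  Applied to any fixed polynomial, all the `∑ᶠ` sums
appearing below have finite support, so they compute the intended operators. -/
noncomputable def aop (n r i j : ℕ) (m : ℤ) : FSp n → FSp n :=
  if h : 1 ≤ i ∧ i ≤ j ∧ j ≤ n then
    (if 0 ≤ m ∧ j ≤ r then fun q => pderiv (Sum.inl (⟨(i, j), h⟩, m)) q
     else fun q => X (Sum.inl (⟨(i, j), h⟩, m)) * q)
  else 0

/-- The operator `a*_{ij,m}`: multiplication by `x_{ij,−m}` if `m ≤ 0` and `j ≤ r`,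
and `−∂/∂x_{ij,−m}` otherwise. -/
noncomputable def astarop (n r i j : ℕ) (m : ℤ) : FSp n → FSp n :=
  if h : 1 ≤ i ∧ i ≤ j ∧ j ≤ n then
    (if m ≤ 0 ∧ j ≤ r then fun q => X (Sum.inl (⟨(i, j), h⟩, -m)) * q
     else fun q => -pderiv (Sum.inl (⟨(i, j), h⟩, -m)) q)
  else 0

/-- The polynomial `e_i·𝐲_m = Σ_{k=1}^n (e_i)_k y_{k,m}`. -/
noncomputable def yPoly (n : ℕ) (e : ℕ → ℕ → ℂ) (i : ℕ) (m : {m : ℕ // 1 ≤ m}) :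
    FSp n :=
  ∑ k : Fin n, e i (k.1 + 1) • X (Sum.inr (k, m))

/-- The operator `b_{i,m}`:  `b_{i,0} = λ_i · id`; for `m > 0`, `b_{i,−m}` is
multiplication by `e_i·𝐲_m` and `b_{i,m} = m Σ_k (e_i)_k ∂/∂y_{k,m}`. -/
noncomputable def bop (n : ℕ) (e : ℕ → ℕ → ℂ) (lam : ℕ → ℂ) (i : ℕ) (m : ℤ) :
    FSp n → FSp n :=
  if h : 0 < m then
    fun q => (m : ℂ) • ∑ k : Fin n,
      e i (k.1 + 1) • pderiv (Sum.inr (k, ⟨m.toNat, by omega⟩)) q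
  else if h' : m = 0 then fun q => lam i • q
  else fun q => yPoly n e i ⟨(-m).toNat, by omega⟩ * q

/-- The normally ordered pair `:a_{ij,u} a*_{kl,v}:` : the annihilation operator
(`a_{ij,u}` with `u ≥ 0`, `j ≤ r`) is moved to the right of the creation operator. -/
noncomputable def nAA (n r i j k l : ℕ) (u v : ℤ) : FSp n → FSp n :=
  if 0 ≤ u ∧ j ≤ r then fun q => astarop n r k l v (aop n r i j u q)
  else fun q => aop n r i j u (astarop n r k l v q)

/-- Mode `m` (coefficient of `z^{−m−1}`) of the normally ordered product
`:a_{ij}(z) a*_{kl}(z):`. -/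
noncomputable def nAAmode (n r i j k l : ℕ) (m : ℤ) : FSp n → FSp n :=
  fun q => ∑ᶠ s : ℤ, nAA n r i j k l s (m - s) q

/-- Normal ordering of the mode `a*_{ij,s}` against an operator `B`: an
annihilating `a*_{ij,s}` (i.e. `s > 0` and `j ≤ r`, or `j > r`) is moved to the
right of `B`. -/
noncomputable def nStar (n r i j : ℕ) (s : ℤ) (B : FSp n → FSp n) : FSp n → FSp n :=
  if (j ≤ r ∧ 0 < s) ∨ r < j then fun q => B (astarop n r i j s q)
  else fun q => astarop n r i j s (B q)

/-- The intermediate Wakimoto mode operator `ρ(H_i)_m`. -/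
noncomputable def rhoH (n r : ℕ) (e : ℕ → ℕ → ℂ) (lam : ℕ → ℂ) (i : ℕ) (m : ℤ) :
    FSp n → FSp n :=
  fun q => (2 : ℂ) • nAAmode n r i i i i m q
    + ∑ j ∈ Finset.Ico 1 i,
        (nAAmode n r j i j i m q - nAAmode n r j (i - 1) j (i - 1) m q)
    + ∑ j ∈ Finset.Icc (i + 1) n,
        (nAAmode n r i j i j m q - nAAmode n r (i + 1) j (i + 1) j m q)
    + bop n e lam i m q

/-- The intermediate Wakimoto mode operator `ρ(F_i)_m`. -/
noncomputable def rhoF (n r i : ℕ) (m : ℤ) : FSp n → FSp n :=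
  fun q => aop n r i i m q
    + ∑ j ∈ Finset.Icc (i + 1) n,
        ∑ᶠ s : ℤ, aop n r i j s (astarop n r (i + 1) j (m - s) q)

/-- The intermediate Wakimoto mode operator `ρ(E_i)_m`. -/
noncomputable def rhoE (n r : ℕ) (γ : ℂ) (e : ℕ → ℕ → ℂ) (lam : ℕ → ℂ) (i : ℕ)
    (m : ℤ) : FSp n → FSp n :=
  fun q =>
    (∑ᶠ s : ℤ, nStar n r i i s
        ((∑ k ∈ Finset.Ico 1 i, nAAmode n r k (i - 1) k (i - 1) (m - s))
          - ∑ k ∈ Finset.Icc 1 i, nAAmode n r k i k i (m - s)) q)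
    + ∑ k ∈ Finset.Icc (i + 1) n,
        ∑ᶠ s : ℤ, aop n r (i + 1) k s (astarop n r i k (m - s) q)
    - ∑ k ∈ Finset.Ico 1 i,
        ∑ᶠ s : ℤ, aop n r k (i - 1) s (astarop n r k i (m - s) q)
    - ∑ᶠ s : ℤ, astarop n r i i s (bop n e lam i (m - s) q)
    - ((if r < i then (r : ℂ) + 1 else (i : ℂ) + 1) - γ ^ 2) •
        ((-(m : ℂ)) • astarop n r i i m q)

/-- Commutator of two operators. -/
noncomputable def opComm (n : ℕ) (A B : FSp n → FSp n) : FSp n → FSp n :=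
  fun q => A (B q) - B (A q)

namespace Wakimoto

attribute [local instance] LieRing.ofAssociativeRing

section LocallyFiniteSums

variable {M : Type*} [AddCommGroup M] [Module ℂ M]

/-- A family of endomorphisms indexed by `ℤ` is locally finite if every vector is killed by all
but finitely many members. -/
def LF (A : ℤ → Module.End ℂ M) : Prop := ∀ q, Function.HasFiniteSupport fun s => A s q

/-- The sum of a locally finite family of endomorphisms (junk value `0` otherwise). -/
noncomputable def lsum (A : ℤ → Module.End ℂ M) : Module.End ℂ M :=
  open Classical in
  if h : LF A then
    { toFun := fun q => ∑ᶠ s, A s q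
      map_add' := fun p q => by
        simp only [map_add]
        exact finsum_add_distrib (h p) (h q)
      map_smul' := fun c q => by
        simp only [map_smul, RingHom.id_apply]
        exact ((DistribSMul.toAddMonoidHom M c).map_finsum (h q)).symm }
  else 0

theorem lsum_apply {A : ℤ → Module.End ℂ M} (h : LF A) (q : M) : lsum A q = ∑ᶠ s, A s q := by
  simp [lsum, h]

theorem LF.of_le {A B : ℤ → Module.End ℂ M} (h : LF A) (hB : ∀ s q, A s q = 0 → B s q = 0) :
    LF B :=
  fun q => (h q).subset fun s hs hA => hs (hB s q hA)

theorem LF.mul_left {A : ℤ → Module.End ℂ M} (h : LF A) (B : ℤ → Module.End ℂ M) :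
    LF fun s => B s * A s :=
  h.of_le fun s q hq => by simp [hq]

theorem LF.mul_right {A : ℤ → Module.End ℂ M} (h : LF A) (B : Module.End ℂ M) :
    LF fun s => A s * B :=
  fun q => h (B q)

theorem LF.add {A B : ℤ → Module.End ℂ M} (hA : LF A) (hB : LF B) : LF fun s => A s + B s :=
  fun q => ((hA q).union (hB q)).subset fun s hs => by
    by_contra hc
    simp only [Set.mem_union, Function.mem_support, not_or, not_not] at hc
    exact hs (by simp [hc.1, hc.2])

theorem LF.neg {A : ℤ → Module.End ℂ M} (hA : LF A) : LF fun s => -A s :=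
  hA.of_le fun s q hq => by simp [hq]

theorem LF.sub {A B : ℤ → Module.End ℂ M} (hA : LF A) (hB : LF B) : LF fun s => A s - B s := by
  simpa only [sub_eq_add_neg] using hA.add hB.neg

theorem LF.lie {A : ℤ → Module.End ℂ M} (hA : LF A) (B : Module.End ℂ M) :
    LF fun s => ⁅B, A s⁆ := by
  simp only [LieRing.of_associative_ring_bracket]
  exact (hA.mul_left fun _ => B).sub (hA.mul_right B)

theorem LF.shift {A : ℤ → Module.End ℂ M} (hA : LF A) (c : ℤ) : LF fun s => A (c + s) :=
  fun q => (hA q).preimage ((add_right_injective c).injOn)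

theorem lf_single (s₀ : ℤ) (B : ℤ → Module.End ℂ M) : LF fun s => if s = s₀ then B s else 0 :=
  fun q => (Set.finite_singleton s₀).subset fun s hs => by
    by_contra hc
    exact hs (by simp [show s ≠ s₀ from hc])

theorem lsum_single (s₀ : ℤ) (B : ℤ → Module.End ℂ M) :
    lsum (fun s => if s = s₀ then B s else 0) = B s₀ := by
  ext q
  rw [lsum_apply (lf_single s₀ B), finsum_eq_single _ s₀ fun s hs => by simp [hs]]
  simp

theorem lsum_zero : lsum (fun _ => (0 : Module.End ℂ M)) = 0 := by
  simpa using lsum_single (M := M) 0 fun _ => 0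

theorem mul_lsum {A : ℤ → Module.End ℂ M} (hA : LF A) (B : Module.End ℂ M) :
    B * lsum A = lsum fun s => B * A s := by
  ext q
  rw [lsum_apply (hA.mul_left fun _ => B), Module.End.mul_apply, lsum_apply hA]
  exact (B.toAddMonoidHom).map_finsum (hA q)

theorem lsum_mul {A : ℤ → Module.End ℂ M} (hA : LF A) (B : Module.End ℂ M) :
    lsum A * B = lsum fun s => A s * B := by
  ext q
  rw [lsum_apply (hA.mul_right B), Module.End.mul_apply, lsum_apply hA]
  rfl

theorem lsum_add {A B : ℤ → Module.End ℂ M} (hA : LF A) (hB : LF B) :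
    lsum A + lsum B = lsum fun s => A s + B s := by
  ext q
  rw [lsum_apply (hA.add hB), LinearMap.add_apply, lsum_apply hA, lsum_apply hB]
  exact (finsum_add_distrib (hA q) (hB q)).symm

theorem smul_lsum {A : ℤ → Module.End ℂ M} (hA : LF A) (c : ℂ) :
    c • lsum A = lsum fun s => c • A s := by
  simpa using mul_lsum hA (c • (1 : Module.End ℂ M))

theorem neg_lsum {A : ℤ → Module.End ℂ M} (hA : LF A) :
    -lsum A = lsum fun s => -A s := by
  simpa using smul_lsum hA (-1)

theorem lsum_sub {A B : ℤ → Module.End ℂ M} (hA : LF A) (hB : LF B) :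
    lsum A - lsum B = lsum fun s => A s - B s := by
  rw [sub_eq_add_neg, neg_lsum hB, lsum_add hA hB.neg]
  simp only [sub_eq_add_neg]

theorem lie_lsum {A : ℤ → Module.End ℂ M} (hA : LF A) (B : Module.End ℂ M) :
    ⁅B, lsum A⁆ = lsum fun s => ⁅B, A s⁆ := by
  simp only [LieRing.of_associative_ring_bracket]
  rw [mul_lsum hA, lsum_mul hA, lsum_sub (hA.mul_left fun _ => B) (hA.mul_right B)]

theorem lsum_lie {A : ℤ → Module.End ℂ M} (hA : LF A) (B : Module.End ℂ M) :
    ⁅lsum A, B⁆ = lsum fun s => ⁅A s, B⁆ := by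
  rw [← lie_skew, lie_lsum hA, neg_lsum (hA.lie B)]
  simp only [lie_skew]

theorem LF.lie' {A : ℤ → Module.End ℂ M} (hA : LF A) (B : Module.End ℂ M) :
    LF fun s => ⁅A s, B⁆ := by
  simpa only [lie_skew] using (hA.lie B).neg

theorem lsum_shift {A : ℤ → Module.End ℂ M} (hA : LF A) (c : ℤ) :
    lsum (fun s => A (c + s)) = lsum A := by
  ext q
  rw [lsum_apply hA, lsum_apply (hA.shift c)]
  exact finsum_comp_equiv (Equiv.addLeft c) (f := fun s => A s q)

/-- `A s q` vanishes for all large `s`. -/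
def VanTop (A : ℤ → Module.End ℂ M) : Prop := ∀ q, ∃ N : ℤ, ∀ s, N < s → A s q = 0

/-- `A s q` vanishes for all sufficiently negative `s`. -/
def VanBot (A : ℤ → Module.End ℂ M) : Prop := ∀ q, ∃ N : ℤ, ∀ s, s < N → A s q = 0

theorem LF.of_van {A : ℤ → Module.End ℂ M} (ht : VanTop A) (hb : VanBot A) : LF A := by
  intro q
  obtain ⟨N, hN⟩ := ht q
  obtain ⟨N', hN'⟩ := hb q
  refine (Set.finite_Icc N' N).subset fun s hs => ?_
  constructor <;> by_contra! hc
  · exact hs (hN' s hc)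
  · exact hs (hN s hc)

theorem VanTop.congr_large {A B : ℤ → Module.End ℂ M} (h : VanTop A) (N : ℤ)
    (hB : ∀ s q, N < s → A s q = 0 → B s q = 0) : VanTop B := fun q => by
  obtain ⟨N', h'⟩ := h q
  exact ⟨max N N', fun s hs => hB s q ((le_max_left _ _).trans_lt hs)
    (h' s ((le_max_right _ _).trans_lt hs))⟩

theorem VanTop.congr_small {A B : ℤ → Module.End ℂ M} (h : VanTop A) (m N : ℤ)
    (hB : ∀ s q, s < N → A (m - s) q = 0 → B s q = 0) : VanBot B := fun q => by
  obtain ⟨N', h'⟩ := h q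
  exact ⟨min N (m - N'), fun s hs => hB s q (hs.trans_le (min_le_left _ _))
    (h' _ (by have := hs.trans_le (min_le_right N (m - N')); omega))⟩

theorem VanTop.sum {ι : Type*} (t : Finset ι) {A : ι → ℤ → Module.End ℂ M}
    (h : ∀ k ∈ t, VanTop (A k)) : VanTop fun s => ∑ k ∈ t, A k s := by
  classical
  intro q
  induction t using Finset.induction_on with
  | empty => exact ⟨0, by simp⟩
  | insert k t hk ih =>
    obtain ⟨N, hN⟩ := ih fun k' hk' => h k' (Finset.mem_insert_of_mem hk')
    obtain ⟨N', hN'⟩ := h k (Finset.mem_insert_self _ _) q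
    refine ⟨max N N', fun s hs => ?_⟩
    have h1 := hN s ((le_max_left _ _).trans_lt hs)
    have h2 := hN' s ((le_max_right _ _).trans_lt hs)
    simp only at h1 ⊢
    rw [Finset.sum_insert hk, LinearMap.add_apply, h1, h2, add_zero]

theorem VanTop.sub {A B : ℤ → Module.End ℂ M} (hA : VanTop A) (hB : VanTop B) :
    VanTop fun s => A s - B s := by
  intro q
  obtain ⟨N, hN⟩ := hA q
  obtain ⟨N', hN'⟩ := hB q
  exact ⟨max N N', fun s hs => by
    rw [LinearMap.sub_apply, hN s ((le_max_left _ _).trans_lt hs),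
      hN' s ((le_max_right _ _).trans_lt hs), sub_zero]⟩

theorem mul_lie (A B C : Module.End ℂ M) : ⁅A * B, C⁆ = A * ⁅B, C⁆ + ⁅A, C⁆ * B := by
  simp only [LieRing.of_associative_ring_bracket]
  noncomm_ring

theorem lie_mul (A B C : Module.End ℂ M) : ⁅C, A * B⁆ = A * ⁅C, B⁆ + ⁅C, A⁆ * B := by
  simp only [LieRing.of_associative_ring_bracket]
  noncomm_ring

theorem bracket_smul (c : ℂ) (A B : Module.End ℂ M) : ⁅A, c • B⁆ = c • ⁅A, B⁆ := by
  simp only [LieRing.of_associative_ring_bracket, mul_smul_comm, smul_mul_assoc, smul_sub]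

theorem smul_bracket (c : ℂ) (A B : Module.End ℂ M) : ⁅c • A, B⁆ = c • ⁅A, B⁆ := by
  simp only [LieRing.of_associative_ring_bracket, mul_smul_comm, smul_mul_assoc, smul_sub]

theorem bracket_one (A : Module.End ℂ M) : ⁅A, (1 : Module.End ℂ M)⁆ = 0 := by
  simp [LieRing.of_associative_ring_bracket]

theorem one_bracket (A : Module.End ℂ M) : ⁅(1 : Module.End ℂ M), A⁆ = 0 := by
  simp [LieRing.of_associative_ring_bracket]

theorem bracket_ite_zero (c : Prop) [Decidable c] (A B : Module.End ℂ M) :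
    ⁅A, if c then B else 0⁆ = if c then ⁅A, B⁆ else 0 := by
  split_ifs <;> simp

theorem ite_zero_bracket (c : Prop) [Decidable c] (A B : Module.End ℂ M) :
    ⁅if c then A else 0, B⁆ = if c then ⁅A, B⁆ else 0 := by
  split_ifs <;> simp

end LocallyFiniteSums

section Weyl

variable {σ : Type*}

/-- Multiplication by a variable. -/
noncomputable def mX (v : σ) : Module.End ℂ (MvPolynomial σ ℂ) := LinearMap.mulLeft ℂ (X v)

/-- Partial derivative as an endomorphism. -/
noncomputable def dX (v : σ) : Module.End ℂ (MvPolynomial σ ℂ) := (pderiv v).toLinearMap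

@[simp] theorem mX_apply (v : σ) (q : MvPolynomial σ ℂ) : mX v q = X v * q := rfl

@[simp] theorem dX_apply (v : σ) (q : MvPolynomial σ ℂ) : dX v q = pderiv v q := rfl

theorem lie_mX_mX (v w : σ) : ⁅mX v, mX w⁆ = 0 := by
  apply LinearMap.ext
  intro q
  simp only [LieRing.of_associative_ring_bracket, LinearMap.sub_apply, Module.End.mul_apply,
    mX_apply, LinearMap.zero_apply]
  ring

theorem lie_dX_dX (v w : σ) : ⁅dX v, dX w⁆ = 0 := by
  classical
  have h : ⁅(pderiv v : Derivation ℂ (MvPolynomial σ ℂ) (MvPolynomial σ ℂ)),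
      (pderiv w : Derivation ℂ (MvPolynomial σ ℂ) (MvPolynomial σ ℂ))⁆ = 0 := by
    apply MvPolynomial.derivation_ext
    intro i
    rw [Derivation.commutator_apply, pderiv_X, pderiv_X]
    simp [Pi.single_apply, apply_ite]
  apply LinearMap.ext
  intro q
  have := congrArg (fun d => d q) h
  simpa [Derivation.commutator_apply, LieRing.of_associative_ring_bracket] using this

theorem lie_dX_mX [DecidableEq σ] (v w : σ) : ⁅dX v, mX w⁆ = if v = w then 1 else 0 := by
  apply LinearMap.ext
  intro q
  by_cases h : v = w
  · subst h
    simp [LieRing.of_associative_ring_bracket]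
  · simp [LieRing.of_associative_ring_bracket, h, pderiv_X_of_ne (Ne.symm h)]

theorem lie_mX_dX [DecidableEq σ] (v w : σ) : ⁅mX v, dX w⁆ = if w = v then -1 else 0 := by
  rw [← lie_skew, lie_dX_mX]
  split_ifs <;> simp

/-- The Euler operator multiplying the variable `X v` by `w v`. -/
noncomputable def euler (w : σ → ℂ) : Module.End ℂ (MvPolynomial σ ℂ) :=
  (mkDerivation ℂ fun v => w v • (X v : MvPolynomial σ ℂ)).toLinearMap

theorem lie_euler_mX (w : σ → ℂ) (v : σ) : ⁅euler w, mX v⁆ = w v • mX v := by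
  apply LinearMap.ext
  intro q
  simp only [euler, LieRing.of_associative_ring_bracket, LinearMap.sub_apply,
    Module.End.mul_apply, mX_apply, LinearMap.smul_apply, Derivation.coeFn_coe,
    Derivation.leibniz, mkDerivation_X, smul_eq_mul, mul_smul_comm, add_sub_cancel_left]
  rw [mul_comm]

theorem lie_euler_dX (w : σ → ℂ) (v : σ) : ⁅euler w, dX v⁆ = -w v • dX v := by
  classical
  have h : ⁅mkDerivation ℂ (fun v => w v • (X v : MvPolynomial σ ℂ)), pderiv v⁆ =
      -w v • (pderiv v : Derivation ℂ (MvPolynomial σ ℂ) (MvPolynomial σ ℂ)) := by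
    apply MvPolynomial.derivation_ext
    intro i
    rw [Derivation.commutator_apply, mkDerivation_X, Derivation.map_smul, Derivation.smul_apply,
      pderiv_X]
    by_cases hi : i = v
    · subst hi
      simp
    · simp [hi]
  apply LinearMap.ext
  intro q
  have := congrArg (fun d => d q) h
  simpa [euler, Derivation.commutator_apply, LieRing.of_associative_ring_bracket] using this

/-- The vacuum expectation value of an endomorphism. -/
noncomputable def vev (T : Module.End ℂ (MvPolynomial σ ℂ)) : ℂ := constantCoeff (T 1)

theorem vev_add (A B : Module.End ℂ (MvPolynomial σ ℂ)) : vev (A + B) = vev A + vev B := by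
  simp [vev]

theorem vev_sub (A B : Module.End ℂ (MvPolynomial σ ℂ)) : vev (A - B) = vev A - vev B := by
  simp [vev]

theorem vev_neg (A : Module.End ℂ (MvPolynomial σ ℂ)) : vev (-A) = -vev A := by
  simp [vev]

theorem vev_smul (c : ℂ) (A : Module.End ℂ (MvPolynomial σ ℂ)) : vev (c • A) = c * vev A := by
  simp [vev]

theorem vev_zero : vev (0 : Module.End ℂ (MvPolynomial σ ℂ)) = 0 := by
  simp [vev]

theorem vev_one : vev (1 : Module.End ℂ (MvPolynomial σ ℂ)) = 1 := by
  simp [vev]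

theorem vev_sum {ι : Type*} (s : Finset ι) (f : ι → Module.End ℂ (MvPolynomial σ ℂ)) :
    vev (∑ i ∈ s, f i) = ∑ i ∈ s, vev (f i) := by
  simp [vev]

theorem vev_lsum {A : ℤ → Module.End ℂ (MvPolynomial σ ℂ)} (hA : LF A)
    (h : ∀ s, vev (A s) = 0) : vev (lsum A) = 0 := by
  rw [vev, lsum_apply hA]
  have := (constantCoeff (σ := σ) (R := ℂ)).toAddMonoidHom.map_finsum (hA 1)
  simp only [vev] at h
  simpa [h] using this

theorem vev_mX_mul (v : σ) (A : Module.End ℂ (MvPolynomial σ ℂ)) : vev (mX v * A) = 0 := by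
  simp [vev]

theorem vev_mul_dX (v : σ) (A : Module.End ℂ (MvPolynomial σ ℂ)) : vev (A * dX v) = 0 := by
  simp [vev]

theorem vev_mul_neg_dX (v : σ) (A : Module.End ℂ (MvPolynomial σ ℂ)) : vev (A * -dX v) = 0 := by
  simp [vev]

theorem eq_C_of_pderiv_eq_zero {p : MvPolynomial σ ℂ} (h : ∀ v, pderiv v p = 0) :
    p = C (constantCoeff p) := by
  classical
  apply MvPolynomial.ext
  intro m
  rw [coeff_C]
  split_ifs with hm
  · rw [← hm]
    rfl
  · obtain ⟨v, hv⟩ : ∃ v, m v ≠ 0 := by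
      by_contra! hc
      exact hm (Finsupp.ext fun v => (hc v).symm)
    have h1 := coeff_pderiv (i := v) p (m - Finsupp.single v 1)
    have h2 : m - Finsupp.single v 1 + Finsupp.single v 1 = m :=
      tsub_add_cancel_of_le (by simpa [Finsupp.single_le_iff] using Nat.one_le_iff_ne_zero.2 hv)
    rw [h v, h2, coeff_zero] at h1
    have h3 : ((m v - 1 : ℕ) : ℂ) + 1 ≠ 0 := Nat.cast_add_one_ne_zero _
    have h4 : coeff m p = 0 ∨ ((m v - 1 : ℕ) : ℂ) + 1 = 0 := by simpa [eq_comm] using h1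
    exact h4.resolve_right h3

/-- Schur's lemma for the Weyl algebra. -/
theorem eq_smul_one_of_commute {T : Module.End ℂ (MvPolynomial σ ℂ)}
    (hm : ∀ v : σ, ⁅T, mX v⁆ = 0) (hd : ∀ v : σ, ⁅T, dX v⁆ = 0) : T = vev T • 1 := by
  have hm' : ∀ v q, T (X v * q) = X v * T q := fun v q => by
    have := LinearMap.congr_fun (hm v) q
    simpa [LieRing.of_associative_ring_bracket, sub_eq_zero] using this
  have hd' : ∀ v, pderiv v (T 1) = 0 := fun v => by
    have := LinearMap.congr_fun (hd v) 1
    simpa [LieRing.of_associative_ring_bracket, sub_eq_zero] using this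
  apply LinearMap.ext
  intro q
  induction q using MvPolynomial.induction_on with
  | C a =>
    have h1 : (C a : MvPolynomial σ ℂ) = a • 1 := by simp [smul_eq_C_mul]
    rw [h1, map_smul, map_smul, eq_C_of_pderiv_eq_zero hd']
    simp [vev, smul_eq_C_mul]
  | add p q hp hq => rw [map_add, map_add, hp, hq]
  | mul_X p v hp => rw [mul_comm, hm', hp]; simp

end Weyl

section Modes

variable (n r : ℕ)

/-- The pair `(x, y)` labels a positive root. -/
def Root (x y : ℕ) : Prop := 1 ≤ x ∧ x ≤ y ∧ y ≤ n

instance (x y : ℕ) : Decidable (Root n x y) := by unfold Root; infer_instance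

/-- The operator `a_{xy,m}` as an endomorphism. -/
noncomputable def aL (x y : ℕ) (m : ℤ) : Module.End ℂ (FSp n) :=
  if h : 1 ≤ x ∧ x ≤ y ∧ y ≤ n then
    (if 0 ≤ m ∧ y ≤ r then dX (Sum.inl (⟨(x, y), h⟩, m)) else mX (Sum.inl (⟨(x, y), h⟩, m)))
  else 0

/-- The operator `a*_{xy,m}` as an endomorphism. -/
noncomputable def sL (x y : ℕ) (m : ℤ) : Module.End ℂ (FSp n) :=
  if h : 1 ≤ x ∧ x ≤ y ∧ y ≤ n then
    (if m ≤ 0 ∧ y ≤ r then mX (Sum.inl (⟨(x, y), h⟩, -m))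
      else -dX (Sum.inl (⟨(x, y), h⟩, -m)))
  else 0

/-- The modes of the orthonormal Heisenberg fields. -/
noncomputable def hL (k : Fin n) (m : ℤ) : Module.End ℂ (FSp n) :=
  if h : 0 < m then (m : ℂ) • dX (Sum.inr (k, ⟨m.toNat, by omega⟩))
  else if h' : m = 0 then 0
  else mX (Sum.inr (k, ⟨(-m).toNat, by omega⟩))

/-- The operator `b_{i,m}` as an endomorphism. -/
noncomputable def bL (e : ℕ → ℕ → ℂ) (lam : ℕ → ℂ) (i : ℕ) (m : ℤ) : Module.End ℂ (FSp n) :=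
  ∑ k : Fin n, e i (k.1 + 1) • hL n k m + if m = 0 then lam i • 1 else 0

variable {n r}

theorem aL_coe (x y : ℕ) (m : ℤ) : ⇑(aL n r x y m) = aop n r x y m := by
  unfold aL aop
  split_ifs <;> rfl

theorem sL_coe (x y : ℕ) (m : ℤ) : ⇑(sL n r x y m) = astarop n r x y m := by
  unfold sL astarop
  split_ifs <;> rfl

theorem bL_coe (e : ℕ → ℕ → ℂ) (lam : ℕ → ℂ) (i : ℕ) (m : ℤ) :
    ⇑(bL n e lam i m) = bop n e lam i m := by
  funext q
  unfold bL bop hL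
  split_ifs with h h'
  · omega
  · simp [LinearMap.sum_apply, Finset.smul_sum, smul_smul, mul_comm]
  · simp
  · simp [LinearMap.sum_apply, yPoly, Finset.sum_mul]

theorem aL_of_not_root {x y : ℕ} (h : ¬Root n x y) (m : ℤ) : aL n r x y m = 0 := dif_neg h

theorem sL_of_not_root {x y : ℕ} (h : ¬Root n x y) (m : ℤ) : sL n r x y m = 0 := dif_neg h

theorem lie_a_s {x y : ℕ} (hxy : Root n x y) (p q : ℕ) (m u : ℤ) :
    ⁅aL n r x y m, sL n r p q u⁆ = if x = p ∧ y = q ∧ m + u = 0 then 1 else 0 := by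
  by_cases hpq : Root n p q
  · unfold Root at hxy hpq
    simp only [aL, sL, hxy, hpq, and_self, dite_true]
    split_ifs with h1 h2 h3 h3 h2 h3 h3
    all_goals
      simp only [lie_neg, lie_dX_mX, lie_mX_dX, lie_dX_dX, lie_mX_mX, Sum.inl.injEq,
        Prod.mk.injEq, Subtype.mk.injEq]
      try split_ifs
      all_goals first
        | rfl
        | (exfalso; omega)
        | simp
  · rw [sL_of_not_root hpq, lie_zero, if_neg]
    rintro ⟨rfl, rfl, -⟩
    exact hpq hxy

theorem lie_s_a {x y : ℕ} (hxy : Root n x y) (p q : ℕ) (m u : ℤ) :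
    ⁅sL n r p q u, aL n r x y m⁆ = if x = p ∧ y = q ∧ m + u = 0 then -1 else 0 := by
  rw [← lie_skew, lie_a_s hxy]
  split_ifs <;> simp

theorem lie_a_a (x y p q : ℕ) (m u : ℤ) : ⁅aL n r x y m, aL n r p q u⁆ = 0 := by
  unfold aL
  split_ifs
  all_goals
    simp only [lie_dX_mX, lie_mX_dX, lie_dX_dX, lie_mX_mX, lie_zero, zero_lie, Sum.inl.injEq,
      Prod.mk.injEq, Subtype.mk.injEq]
    try split_ifs
    all_goals first
      | rfl
      | (exfalso; omega)

theorem lie_s_s (x y p q : ℕ) (m u : ℤ) : ⁅sL n r x y m, sL n r p q u⁆ = 0 := by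
  unfold sL
  split_ifs
  all_goals
    simp only [lie_neg, neg_lie, lie_dX_mX, lie_mX_dX, lie_dX_dX, lie_mX_mX, lie_zero, zero_lie,
      Sum.inl.injEq, Prod.mk.injEq, Subtype.mk.injEq]
    try split_ifs
    all_goals first
      | rfl
      | (exfalso; omega)
      | simp

theorem lie_a_h (x y : ℕ) (k : Fin n) (m u : ℤ) : ⁅aL n r x y m, hL n k u⁆ = 0 := by
  unfold aL hL
  split_ifs <;> simp [bracket_smul, lie_dX_mX, lie_mX_dX, lie_dX_dX, lie_mX_mX]

theorem lie_s_h (x y : ℕ) (k : Fin n) (m u : ℤ) : ⁅sL n r x y m, hL n k u⁆ = 0 := by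
  unfold sL hL
  split_ifs <;> simp [bracket_smul, lie_dX_mX, lie_mX_dX, lie_dX_dX, lie_mX_mX]

theorem lie_h_h (k l : Fin n) (m u : ℤ) :
    ⁅hL n k m, hL n l u⁆ = if k = l ∧ m + u = 0 then (m : ℂ) • 1 else 0 := by
  unfold hL
  by_cases hkl : k = l
  · subst hkl
    split_ifs
    all_goals
      simp only [bracket_smul, smul_bracket, lie_dX_mX, lie_mX_dX, lie_dX_dX, lie_mX_mX, lie_zero,
        zero_lie, Sum.inr.injEq, Prod.mk.injEq, Subtype.mk.injEq, true_and]
      try split_ifs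
      all_goals first
        | rfl
        | (exfalso; omega)
        | (have h0 : u = -m := by omega
           subst h0
           simp)
        | simp [show m = 0 by omega]
        | simp
  · have hlk : l ≠ k := Ne.symm hkl
    split_ifs <;> simp_all [bracket_smul, smul_bracket, lie_dX_mX, lie_mX_dX, lie_dX_dX, lie_mX_mX]

theorem lie_b_h (e : ℕ → ℕ → ℂ) (lam : ℕ → ℂ) (i : ℕ) (k : Fin n) (m u : ℤ) :
    ⁅bL n e lam i m, hL n k u⁆ = if m + u = 0 then ((m : ℂ) * e i (k.1 + 1)) • 1 else 0 := by
  have h0 : ⁅(if m = 0 then lam i • 1 else 0 : Module.End ℂ (FSp n)), hL n k u⁆ = 0 := by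
    split_ifs <;> simp [LieRing.of_associative_ring_bracket]
  rw [bL, add_lie, h0, add_zero, sum_lie]
  simp only [smul_bracket, lie_h_h]
  rw [Finset.sum_eq_single k]
  · simp [smul_smul, mul_comm]
  · intro l _ hl
    simp [hl]
  · simp

theorem lie_b_of_lie_h {e : ℕ → ℕ → ℂ} {lam : ℕ → ℂ} {i : ℕ} {m : ℤ} {T : Module.End ℂ (FSp n)}
    (h : ∀ k, ⁅T, hL n k m⁆ = 0) : ⁅T, bL n e lam i m⁆ = 0 := by
  have h0 : ⁅T, (if m = 0 then lam i • 1 else 0 : Module.End ℂ (FSp n))⁆ = 0 := by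
    split_ifs <;> simp [LieRing.of_associative_ring_bracket]
  rw [bL, lie_add, h0, lie_sum]
  simp [bracket_smul, h]

theorem lie_b_b {e : ℕ → ℕ → ℂ} {lam : ℕ → ℂ} {i j : ℕ} (m u : ℤ) :
    ⁅bL n e lam i m, bL n e lam j u⁆ =
      if m + u = 0 then ((m : ℂ) * ∑ k : Fin n, e i (k.1 + 1) * e j (k.1 + 1)) • 1 else 0 := by
  have h0 : ⁅bL n e lam i m, (if u = 0 then lam j • 1 else 0 : Module.End ℂ (FSp n))⁆ = 0 := by
    split_ifs <;> simp [LieRing.of_associative_ring_bracket]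
  conv_lhs => rw [bL.eq_def n e lam j]
  rw [lie_add, h0, lie_sum, add_zero]
  simp only [bracket_smul, lie_b_h]
  split_ifs
  · simp only [smul_smul, ← Finset.sum_smul, Finset.mul_sum]
    congr 1
    exact Finset.sum_congr rfl fun k _ => by ring
  · simp

theorem hL_pos (k : Fin n) (m : ℕ) (hm : 1 ≤ m) :
    hL n k m = ((m : ℤ) : ℂ) • dX (Sum.inr (k, ⟨m, hm⟩)) := by
  rw [hL, dif_pos (by omega)]
  rfl

theorem hL_neg (k : Fin n) (m : ℕ) (hm : 1 ≤ m) : hL n k (-m) = mX (Sum.inr (k, ⟨m, hm⟩)) := by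
  rw [hL, dif_neg (by omega), dif_neg (by omega)]
  simp only [neg_neg, Int.toNat_natCast]

/-- Schur's lemma for the mode operators. -/
theorem eq_smul_one {T : Module.End ℂ (FSp n)}
    (ha : ∀ x y m, Root n x y → ⁅T, aL n r x y m⁆ = 0)
    (hs : ∀ x y m, Root n x y → ⁅T, sL n r x y m⁆ = 0)
    (hh : ∀ k m, ⁅T, hL n k m⁆ = 0) : T = vev T • 1 := by
  apply eq_smul_one_of_commute
  · rintro (⟨⟨⟨x, y⟩, hxy⟩, m⟩ | ⟨k, m, hm⟩)
    · have h1 := ha x y m hxy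
      have h2 := hs x y (-m) hxy
      simp only at hxy
      simp only [aL, sL, hxy, and_self, dite_true, neg_neg, Left.neg_nonpos_iff] at h1 h2
      split_ifs at h1 h2
      · exact h2
      · exact h1
    · rw [← hL_neg]
      exact hh k _
  · rintro (⟨⟨⟨x, y⟩, hxy⟩, m⟩ | ⟨k, m, hm⟩)
    · have h1 := ha x y m hxy
      have h2 := hs x y (-m) hxy
      simp only at hxy
      simp only [aL, sL, hxy, and_self, dite_true, neg_neg, Left.neg_nonpos_iff] at h1 h2
      split_ifs at h1 h2
      · exact h1
      · rwa [lie_neg, neg_eq_zero] at h2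
    · have h1 := hh k m
      rw [hL_pos k m hm, bracket_smul] at h1
      have hm0 : ((m : ℤ) : ℂ) ≠ 0 := by
        simpa using Nat.one_le_iff_ne_zero.1 hm
      exact (smul_eq_zero.1 h1).resolve_left hm0

/-- Weights of the variables: `X_{xy,m}` has weight `±(H (y+1) - H x)`. -/
noncomputable def wt (n r : ℕ) (H : ℕ → ℂ) : XIdx n ⊕ YIdx n → ℂ
  | Sum.inl (v, m) =>
    if 0 ≤ m ∧ v.1.2 ≤ r then H (v.1.2 + 1) - H v.1.1 else -(H (v.1.2 + 1) - H v.1.1)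
  | Sum.inr _ => 0

theorem lie_euler_a (H : ℕ → ℂ) (x y : ℕ) (m : ℤ) :
    ⁅euler (wt n r H), aL n r x y m⁆ = (-(H (y + 1) - H x)) • aL n r x y m := by
  unfold aL
  split_ifs with h h1
  · simp [lie_euler_dX, wt, h1]
  · rw [lie_euler_mX]
    simp only [wt, h1, if_false]
  · simp

theorem lie_euler_s (H : ℕ → ℂ) (x y : ℕ) (m : ℤ) :
    ⁅euler (wt n r H), sL n r x y m⁆ = (H (y + 1) - H x) • sL n r x y m := by
  unfold sL
  split_ifs with h h1
  · have h2 : 0 ≤ -m ∧ y ≤ r := by omega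
    rw [lie_euler_mX]
    simp only [wt, h2, and_self, if_true]
  · have h2 : ¬(0 ≤ -m ∧ y ≤ r) := by omega
    rw [lie_neg, lie_euler_dX]
    simp only [wt, h2, if_false, neg_neg, smul_neg]
  · simp

theorem lie_euler_h (H : ℕ → ℂ) (k : Fin n) (m : ℤ) : ⁅euler (wt n r H), hL n k m⁆ = 0 := by
  unfold hL
  split_ifs
  · simp [bracket_smul, lie_euler_dX, wt]
  · simp
  · simp [lie_euler_mX, wt]

theorem eq_zero_of_weight {T : Module.End ℂ (FSp n)} {H : ℕ → ℂ} {w : ℂ}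
    (hT : T = vev T • 1) (hw : ⁅euler (wt n r H), T⁆ = w • T) (h0 : w ≠ 0) : T = 0 := by
  have h1 : ⁅euler (wt n r H), T⁆ = 0 := by
    rw [hT]
    simp [LieRing.of_associative_ring_bracket]
  rw [h1] at hw
  exact (smul_eq_zero.1 hw.symm).resolve_left h0

end Modes

section NormalOrder

variable {n r : ℕ}

theorem exists_pderiv_bound (q : FSp n) :
    ∃ N : ℕ, (∀ v m, (N : ℤ) < |m| → pderiv (Sum.inl (v, m) : XIdx n ⊕ YIdx n) q = 0) ∧
      ∀ k m, N < m.1 → pderiv (Sum.inr (k, m) : XIdx n ⊕ YIdx n) q = 0 := by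
  refine ⟨q.vars.sup fun v => v.elim (fun v => v.2.natAbs) fun v => v.2.1, ?_, ?_⟩
  · intro v m hm
    refine pderiv_eq_zero_of_notMem_vars fun hv => ?_
    have := Finset.le_sup (f := fun v : XIdx n ⊕ YIdx n =>
      v.elim (fun v => v.2.natAbs) fun v => v.2.1) hv
    simp only [Sum.elim_inl] at this
    rw [Int.abs_eq_natAbs] at hm
    omega
  · intro v m hm
    refine pderiv_eq_zero_of_notMem_vars fun hv => ?_
    have := Finset.le_sup (f := fun v : XIdx n ⊕ YIdx n =>
      v.elim (fun v => v.2.natAbs) fun v => v.2.1) hv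
    simp only [Sum.elim_inr] at this
    omega

theorem vanTop_a {x y : ℕ} (hy : y ≤ r) : VanTop (aL n r x y) := by
  intro q
  obtain ⟨N, hN, -⟩ := exists_pderiv_bound q
  refine ⟨N, fun s hs => ?_⟩
  unfold aL
  split_ifs with h h1
  · exact hN _ _ (by rw [abs_of_nonneg] <;> omega)
  · omega
  · rfl

theorem vanTop_s (x y : ℕ) : VanTop (sL n r x y) := by
  intro q
  obtain ⟨N, hN, -⟩ := exists_pderiv_bound q
  refine ⟨N, fun s hs => ?_⟩
  unfold sL
  split_ifs with h h1
  · omega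
  · exact neg_eq_zero.2 (hN _ _ (by rw [abs_neg, abs_of_nonneg] <;> omega))
  · rfl

theorem vanBot_s {x y : ℕ} (hy : r < y) : VanBot (sL n r x y) := by
  intro q
  obtain ⟨N, hN, -⟩ := exists_pderiv_bound q
  refine ⟨-N, fun s hs => ?_⟩
  unfold sL
  split_ifs with h h1
  · omega
  · exact neg_eq_zero.2 (hN _ _ (by rw [abs_neg, abs_of_nonpos] <;> omega))
  · rfl

theorem vanTop_b (e : ℕ → ℕ → ℂ) (lam : ℕ → ℂ) (i : ℕ) : VanTop (bL n e lam i) := by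
  intro q
  obtain ⟨N, -, hN⟩ := exists_pderiv_bound q
  refine ⟨N, fun s hs => ?_⟩
  have h0 : 0 < s := by omega
  rw [bL, if_neg h0.ne', add_zero, LinearMap.sum_apply]
  refine Finset.sum_eq_zero fun k _ => ?_
  rw [hL, dif_pos h0, LinearMap.smul_apply, LinearMap.smul_apply, dX_apply, hN, smul_zero,
    smul_zero]
  simp only
  omega

/-- Products of commuting families that vanish for large indices are locally finite. -/
theorem LF.of_vanTop {M : Type*} [AddCommGroup M] [Module ℂ M] {A B : ℤ → Module.End ℂ M} {m : ℤ}
    (hA : VanTop A) (hB : VanTop B) (hc : ∀ s, ⁅A s, B (m - s)⁆ = 0) :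
    LF fun s => A s * B (m - s) := by
  refine LF.of_van (hA.congr_large 0 fun s q _ h => ?_) (hB.congr_small m 0 fun s q _ h => ?_)
  · have := sub_eq_zero.1 ((LieRing.of_associative_ring_bracket _ _).symm.trans (hc s))
    rw [this, Module.End.mul_apply, h, map_zero]
  · rw [Module.End.mul_apply, h, map_zero]

variable (n r)

/-- The operators `a*_{xy,m}`, extended by `a*_{y+1,y}(z) = 1`. -/
noncomputable def sX (x y : ℕ) (m : ℤ) : Module.End ℂ (FSp n) :=
  if x = y + 1 then (if m = 0 then 1 else 0) else sL n r x y m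

/-- The normally ordered pair `:a_{xy,u} a*_{pq,v}:` as an endomorphism. -/
noncomputable def nAAL (x y p q : ℕ) (u v : ℤ) : Module.End ℂ (FSp n) :=
  if 0 ≤ u ∧ y ≤ r then sL n r p q v * aL n r x y u else aL n r x y u * sL n r p q v

/-- The modes of the normally ordered product `:a_{xy}(z) a*_{pq}(z):`. -/
noncomputable def NL (x y p q : ℕ) (m : ℤ) : Module.End ℂ (FSp n) :=
  lsum fun u => nAAL n r x y p q u (m - u)

variable {n r}

theorem sX_of_root {x y : ℕ} (h : Root n x y) (m : ℤ) : sX n r x y m = sL n r x y m :=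
  if_neg fun h1 => by have := h.2.1; omega

theorem sX_succ (y : ℕ) (m : ℤ) : sX n r (y + 1) y m = if m = 0 then 1 else 0 := if_pos rfl

theorem vanTop_sX (x y : ℕ) : VanTop (sX n r x y) := by
  refine (vanTop_s (n := n) (r := r) x y).congr_large 0 fun s q hs h => ?_
  unfold sX
  split_ifs
  · omega
  · rfl
  · exact h

theorem lie_sX_sX (x y p q : ℕ) (m u : ℤ) : ⁅sX n r x y m, sX n r p q u⁆ = 0 := by
  unfold sX
  split_ifs <;> simp [lie_s_s, bracket_one, one_bracket]

theorem lie_sX_h (x y : ℕ) (k : Fin n) (m u : ℤ) : ⁅sX n r x y m, hL n k u⁆ = 0 := by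
  unfold sX
  split_ifs <;> simp [lie_s_h, one_bracket]

theorem lie_s_b (x y : ℕ) (e : ℕ → ℕ → ℂ) (lam : ℕ → ℂ) (i : ℕ) (m u : ℤ) :
    ⁅sL n r x y m, bL n e lam i u⁆ = 0 :=
  lie_b_of_lie_h fun k => lie_s_h x y k m u

theorem lie_a_b (x y : ℕ) (e : ℕ → ℕ → ℂ) (lam : ℕ → ℂ) (i : ℕ) (m u : ℤ) :
    ⁅aL n r x y m, bL n e lam i u⁆ = 0 :=
  lie_b_of_lie_h fun k => lie_a_h x y k m u

theorem lie_b_a (x y : ℕ) (e : ℕ → ℕ → ℂ) (lam : ℕ → ℂ) (i : ℕ) (m u : ℤ) :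
    ⁅bL n e lam i u, aL n r x y m⁆ = 0 := by
  rw [← lie_skew, lie_a_b, neg_zero]

theorem lie_b_s (x y : ℕ) (e : ℕ → ℕ → ℂ) (lam : ℕ → ℂ) (i : ℕ) (m u : ℤ) :
    ⁅bL n e lam i u, sL n r x y m⁆ = 0 := by
  rw [← lie_skew, lie_s_b, neg_zero]

theorem nAAL_of_ne {x y p q : ℕ} (h : ¬(x = p ∧ y = q)) (u v : ℤ) :
    nAAL n r x y p q u v = aL n r x y u * sL n r p q v := by
  unfold nAAL
  split_ifs
  · by_cases hr : Root n x y
    · have := lie_a_s (r := r) hr p q u v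
      rw [if_neg (by tauto), LieRing.of_associative_ring_bracket, sub_eq_zero] at this
      exact this.symm
    · rw [aL_of_not_root hr, mul_zero, zero_mul]
  · rfl

theorem nAAL_of_add_ne {x y p q : ℕ} {u v : ℤ} (h : u + v ≠ 0) :
    nAAL n r x y p q u v = aL n r x y u * sL n r p q v := by
  unfold nAAL
  split_ifs
  · by_cases hr : Root n x y
    · have := lie_a_s (r := r) hr p q u v
      rw [if_neg (by tauto), LieRing.of_associative_ring_bracket, sub_eq_zero] at this
      exact this.symm
    · rw [aL_of_not_root hr, mul_zero, zero_mul]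
  · rfl

theorem nAAL_of_lt {x y p q : ℕ} {u v : ℤ} (h : ¬(0 ≤ u ∧ y ≤ r)) :
    nAAL n r x y p q u v = aL n r x y u * sL n r p q v := if_neg h

theorem nAAL_of_le {x y p q : ℕ} {u v : ℤ} (h : 0 ≤ u ∧ y ≤ r) :
    nAAL n r x y p q u v = sL n r p q v * aL n r x y u := if_pos h

theorem lf_nAAL {x y p q : ℕ} (hyq : y ≤ q) (m : ℤ) :
    LF fun u => nAAL n r x y p q u (m - u) := by
  by_cases hy : y ≤ r
  · refine LF.of_van ((vanTop_a (n := n) (x := x) hy).congr_large 0 fun u z hu h => ?_)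
      ((vanTop_s (n := n) (r := r) p q).congr_small m 0 fun u z hu h => ?_)
    · rw [nAAL_of_le ⟨hu.le, hy⟩, Module.End.mul_apply, h, map_zero]
    · rw [nAAL_of_lt (by omega), Module.End.mul_apply, h, map_zero]
  · have hs : LF fun u => sL n r p q (m - u) := by
      have h0 : LF (sL n r p q) := LF.of_van (vanTop_s p q) (vanBot_s (by omega))
      exact fun z => (h0 z).preimage (sub_right_injective.injOn)
    refine (hs.mul_left fun u => aL n r x y u).of_le fun u z h => ?_
    rwa [nAAL_of_lt (by omega)]

theorem lie_nAAL_a {x y p q : ℕ} {x' y' : ℕ} (h : Root n x' y') (u v w : ℤ) :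
    ⁅nAAL n r x y p q u v, aL n r x' y' w⁆ =
      if p = x' ∧ q = y' ∧ v + w = 0 then -aL n r x y u else 0 := by
  have h1 := lie_s_a (r := r) h p q w v
  have h2 := lie_a_a (n := n) (r := r) x y x' y' u w
  have h3 : (x' = p ∧ y' = q ∧ w + v = 0) ↔ (p = x' ∧ q = y' ∧ v + w = 0) := by
    rw [add_comm, eq_comm, @eq_comm _ y']
  simp only [h3] at h1
  unfold nAAL
  split_ifs at h1 ⊢ <;> rw [mul_lie, h1, h2]
  · rw [mul_zero, zero_add]
    exact LinearMap.ext fun z => by simp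
  · simp
  · rw [zero_mul, add_zero]
    exact LinearMap.ext fun z => by simp
  · simp

theorem lie_nAAL_s {x y p q : ℕ} {x' y' : ℕ} (h : Root n x' y') (u v w : ℤ) :
    ⁅nAAL n r x y p q u v, sL n r x' y' w⁆ =
      if x = x' ∧ y = y' ∧ u + w = 0 then sL n r p q v else 0 := by
  have h2 := lie_s_s (n := n) (r := r) p q x' y' v w
  by_cases hr : Root n x y
  · have h1 := lie_a_s (r := r) hr x' y' u w
    unfold nAAL
    split_ifs at h1 ⊢ <;> rw [mul_lie, h1, h2] <;> simp
  · rw [if_neg]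
    · unfold nAAL
      split_ifs <;> simp [aL_of_not_root hr]
    · rintro ⟨rfl, rfl, -⟩
      exact hr h

theorem lie_nAAL_h {x y p q : ℕ} (k : Fin n) (u v w : ℤ) :
    ⁅nAAL n r x y p q u v, hL n k w⁆ = 0 := by
  unfold nAAL
  split_ifs <;> simp [mul_lie, lie_a_h, lie_s_h]

theorem vev_nAAL (x y p q : ℕ) (u v : ℤ) : vev (nAAL n r x y p q u v) = 0 := by
  unfold nAAL aL sL
  split_ifs <;> simp [vev_mX_mul, vev_mul_dX, vev_zero]

theorem lie_N_a {x y p q : ℕ} (hyq : y ≤ q) {x' y' : ℕ} (h : Root n x' y') (m w : ℤ) :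
    ⁅NL n r x y p q m, aL n r x' y' w⁆ =
      if p = x' ∧ q = y' then -aL n r x y (m + w) else 0 := by
  rw [NL, lsum_lie (lf_nAAL hyq m)]
  simp only [lie_nAAL_a h]
  by_cases hc : p = x' ∧ q = y'
  · rw [if_pos hc]
    convert lsum_single (m + w) fun u => -aL n r x y u using 4 with u
    simp only [hc, true_and]
    constructor <;> intro <;> omega
  · rw [if_neg hc]
    convert lsum_zero (M := FSp n) using 3 with u
    rw [if_neg (by tauto)]

theorem lie_N_s {x y p q : ℕ} (hyq : y ≤ q) {x' y' : ℕ} (h : Root n x' y') (m w : ℤ) :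
    ⁅NL n r x y p q m, sL n r x' y' w⁆ =
      if x = x' ∧ y = y' then sL n r p q (m + w) else 0 := by
  rw [NL, lsum_lie (lf_nAAL hyq m)]
  simp only [lie_nAAL_s h]
  by_cases hc : x = x' ∧ y = y'
  · rw [if_pos hc]
    convert lsum_single (-w) fun u => sL n r p q (m - u) using 4 with u
    · simp only [hc, true_and]
      constructor <;> intro <;> omega
    · omega
  · rw [if_neg hc]
    convert lsum_zero (M := FSp n) using 3 with u
    rw [if_neg (by tauto)]

theorem lie_N_h {x y p q : ℕ} (hyq : y ≤ q) (k : Fin n) (m w : ℤ) :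
    ⁅NL n r x y p q m, hL n k w⁆ = 0 := by
  rw [NL, lsum_lie (lf_nAAL hyq m)]
  simp only [lie_nAAL_h, lsum_zero]

theorem vev_N {x y p q : ℕ} (hyq : y ≤ q) (m : ℤ) : vev (NL n r x y p q m) = 0 :=
  vev_lsum (lf_nAAL hyq m) fun _ => vev_nAAL _ _ _ _ _ _

theorem lie_euler_N {x y p q : ℕ} (hyq : y ≤ q) (H : ℕ → ℂ) (m : ℤ) :
    ⁅euler (wt n r H), NL n r x y p q m⁆ =
      ((H (q + 1) - H p) - (H (y + 1) - H x)) • NL n r x y p q m := by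
  rw [NL, lie_lsum (lf_nAAL hyq m), smul_lsum (lf_nAAL hyq m)]
  congr 1
  funext u
  unfold nAAL
  split_ifs <;> rw [lie_mul, lie_euler_a, lie_euler_s, mul_smul_comm, smul_mul_assoc] <;> module

theorem vanTop_N {x y : ℕ} (hy : y ≤ r) : VanTop (NL n r x y x y) := by
  intro z
  obtain ⟨N₁, h₁⟩ := vanTop_a (n := n) (x := x) hy z
  obtain ⟨N₂, h₂⟩ := vanTop_s (n := n) (r := r) x y z
  refine ⟨max 0 (max (N₁ + N₂) N₂), fun m hm => ?_⟩
  rw [NL, lsum_apply (lf_nAAL le_rfl m)]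
  refine finsum_eq_zero_of_forall_eq_zero fun u => ?_
  by_cases hu : N₂ < m - u
  · rw [nAAL_of_add_ne (by omega), Module.End.mul_apply, h₂ _ hu, map_zero]
  · rw [nAAL_of_le (by omega), Module.End.mul_apply, h₁ _ (by omega), map_zero]

end NormalOrder

section FOperators

variable {n r : ℕ}

theorem lie_N_a_of_root {x y p q : ℕ} (hyq : y ≤ q) (h : Root n p q) (x' y' : ℕ) (m w : ℤ) :
    ⁅NL n r x y p q m, aL n r x' y' w⁆ =
      if p = x' ∧ q = y' then -aL n r x y (m + w) else 0 := by
  by_cases h' : Root n x' y'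
  · exact lie_N_a hyq h' m w
  · rw [aL_of_not_root h', lie_zero, if_neg]
    rintro ⟨rfl, rfl⟩
    exact h' h

theorem lie_N_sX {x y p q : ℕ} (hyq : y ≤ q) (h : Root n x y) (x' y' : ℕ) (m w : ℤ) :
    ⁅NL n r x y p q m, sX n r x' y' w⁆ =
      if x = x' ∧ y = y' then sL n r p q (m + w) else 0 := by
  by_cases h' : Root n x' y'
  · rw [sX_of_root h', lie_N_s hyq h' m w]
  · rw [if_neg]
    · unfold sX
      split_ifs <;> simp [bracket_one, sL_of_not_root h']
    · rintro ⟨rfl, rfl⟩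
      exact h' h

variable (n r)

/-- The operator `ρ(F_i)_m` as an endomorphism. -/
noncomputable def FL (i : ℕ) (m : ℤ) : Module.End ℂ (FSp n) :=
  aL n r i i m + ∑ j ∈ Finset.Icc (i + 1) n, NL n r i j (i + 1) j m

variable {n r}

theorem FL_coe (i : ℕ) (m : ℤ) : ⇑(FL n r i m) = rhoF n r i m := by
  funext q
  rw [FL, LinearMap.add_apply, LinearMap.sum_apply, rhoF, aL_coe]
  congr 1
  refine Finset.sum_congr rfl fun j _ => ?_
  rw [NL, lsum_apply (lf_nAAL le_rfl m)]
  refine finsum_congr fun s => ?_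
  rw [nAAL_of_ne (by omega), Module.End.mul_apply, aL_coe, sL_coe]

theorem lie_F_a {k : ℕ} (hk : 1 ≤ k) (x y : ℕ) (u v : ℤ) :
    ⁅FL n r k u, aL n r x y v⁆ = if x = k + 1 ∧ x ≤ y then -aL n r k y (u + v) else 0 := by
  rw [FL, add_lie, lie_a_a, zero_add, sum_lie]
  rw [Finset.sum_congr rfl fun j hj => lie_N_a_of_root le_rfl
    (⟨by omega, by simp at hj; omega, by simp at hj; omega⟩ : Root n (k + 1) j) x y u v]
  by_cases hx : x = k + 1
  · subst hx
    simp only [true_and, Finset.sum_ite_eq', Finset.mem_Icc]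
    split_ifs with h1 h2 h2
    · rfl
    · omega
    · rw [aL_of_not_root (by unfold Root; omega), neg_zero]
    · rfl
  · rw [if_neg (by tauto)]
    exact Finset.sum_eq_zero fun j _ => if_neg fun h => hx h.1.symm

theorem lie_F_sX {k : ℕ} (hk : 1 ≤ k) (hkn : k ≤ n) (x y : ℕ) (u v : ℤ) :
    ⁅FL n r k u, sX n r x y v⁆ = if x = k then sX n r (k + 1) y (u + v) else 0 := by
  have hr : Root n k k := ⟨hk, le_rfl, hkn⟩
  have h1 : ⁅aL n r k k u, sX n r x y v⁆ = if x = k ∧ y = k ∧ u + v = 0 then 1 else 0 := by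
    unfold sX
    split_ifs with h1 h2 h3 h3 h3
    · omega
    · exact bracket_one _
    · omega
    · exact lie_zero _
    · rw [lie_a_s hr, if_pos ⟨h3.1.symm, h3.2.1.symm, h3.2.2⟩]
    · rw [lie_a_s hr, if_neg (by tauto)]
  rw [FL, add_lie, h1, sum_lie]
  rw [Finset.sum_congr rfl fun j hj => lie_N_sX le_rfl
    (⟨by omega, by simp at hj; omega, by simp at hj; omega⟩ : Root n k j) x y u v]
  by_cases hx : x = k
  · subst hx
    simp only [true_and, if_true, Finset.sum_ite_eq', Finset.mem_Icc]
    by_cases hy : y = x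
    · subst hy
      rw [sX_succ, if_neg (show ¬(y + 1 ≤ y ∧ y ≤ n) by omega), add_zero]
      simp
    · simp only [hy, false_and, if_false, zero_add]
      rw [sX, if_neg (show ¬x + 1 = y + 1 by omega)]
      split_ifs with h2
      · rfl
      · rw [sL_of_not_root fun h => h2 h.2]
  · rw [if_neg hx, if_neg (by tauto), zero_add]
    exact Finset.sum_eq_zero fun j _ => if_neg fun h => hx h.1.symm

theorem lie_F_h (k : ℕ) (l : Fin n) (u v : ℤ) : ⁅FL n r k u, hL n l v⁆ = 0 := by
  rw [FL, add_lie, lie_a_h, zero_add, sum_lie]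
  exact Finset.sum_eq_zero fun j _ => lie_N_h le_rfl l u v

theorem lie_euler_F (H : ℕ → ℂ) (k : ℕ) (u : ℤ) :
    ⁅euler (wt n r H), FL n r k u⁆ = (-(H (k + 1) - H k)) • FL n r k u := by
  rw [FL, lie_add, lie_euler_a, lie_sum, smul_add, Finset.smul_sum]
  congr 1
  refine Finset.sum_congr rfl fun j _ => ?_
  rw [lie_euler_N le_rfl]
  congr 1
  ring

theorem sL_eq_sX {x y : ℕ} (h : x ≤ y) (m : ℤ) : sL n r x y m = sX n r x y m :=
  (if_neg (by omega)).symm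

/-- An operator commuting with all modes and of nonzero weight vanishes. -/
theorem eq_zero_of_commute {T : Module.End ℂ (FSp n)} (H : ℕ → ℂ) {w : ℂ}
    (ha : ∀ x y m, ⁅T, aL n r x y m⁆ = 0) (hs : ∀ x y m, ⁅T, sX n r x y m⁆ = 0)
    (hh : ∀ k m, ⁅T, hL n k m⁆ = 0) (hw : ⁅euler (wt n r H), T⁆ = w • T) (h0 : w ≠ 0) : T = 0 :=
  eq_zero_of_weight (eq_smul_one (fun x y m _ => ha x y m)
    (fun x y m h => by rw [sL_eq_sX h.2.1]; exact hs x y m) hh) hw h0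

theorem lie_euler_lie {A B D : Module.End ℂ (FSp n)} {a b : ℂ} (hA : ⁅D, A⁆ = a • A)
    (hB : ⁅D, B⁆ = b • B) : ⁅D, ⁅A, B⁆⁆ = (a + b) • ⁅A, B⁆ := by
  rw [leibniz_lie, hA, hB, bracket_smul, smul_bracket, add_smul]

theorem lie_F_F {i j : ℕ} (hi : 1 ≤ i) (hin : i ≤ n) (hj : 1 ≤ j) (hjn : j ≤ n)
    (hij : ¬(i + 1 = j ∨ j + 1 = i)) (m p : ℤ) : ⁅FL n r i m, FL n r j p⁆ = 0 := by
  have hw (k : ℕ) (u : ℤ) := lie_euler_F (n := n) (r := r) (fun x => (x : ℂ)) k u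
  refine eq_zero_of_commute (r := r) (fun x => (x : ℂ)) (w := -2) ?_ ?_ ?_ ?_ (by norm_num)
  · intro x y u
    simp only [lie_lie, lie_F_a hi, lie_F_a hj, bracket_ite_zero, lie_neg]
    split_ifs <;> first | omega | simp
  · intro x y u
    simp only [lie_lie, lie_F_sX hi hin, lie_F_sX hj hjn, bracket_ite_zero]
    split_ifs <;> first | omega | simp
  · intro k u
    rw [lie_lie, lie_F_h, lie_F_h]
    simp
  · rw [lie_euler_lie (hw i m) (hw j p)]
    congr 1
    push_cast
    ring

theorem lie_F_F_F {i j : ℕ} (hi : 1 ≤ i) (hin : i ≤ n) (hj : 1 ≤ j) (hjn : j ≤ n)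
    (hij : i + 1 = j ∨ j + 1 = i) (m u p : ℤ) : ⁅FL n r i m, ⁅FL n r i u, FL n r j p⁆⁆ = 0 := by
  have hw (k : ℕ) (u : ℤ) := lie_euler_F (n := n) (r := r) (fun x => (x : ℂ)) k u
  refine eq_zero_of_commute (r := r) (fun x => (x : ℂ)) (w := -3) ?_ ?_ ?_ ?_ (by norm_num)
  · intro x y v
    simp only [lie_lie, lie_F_a hi, lie_F_a hj, bracket_ite_zero, lie_neg, lie_sub]
    split_ifs <;> first | omega | simp
  · intro x y v
    simp only [lie_lie, lie_F_sX hi hin, lie_F_sX hj hjn, bracket_ite_zero, lie_sub]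
    split_ifs <;> first | omega | simp
  · intro k u
    simp only [lie_lie, lie_F_h]
    simp
  · rw [lie_euler_lie (hw i m) (lie_euler_lie (hw i u) (hw j p))]
    congr 1
    push_cast
    ring

end FOperators

section EOperators

variable (n r : ℕ)

/-- The modes of the Cartan-type field multiplying `a*_{ii}` in `ρ(E_i)`. -/
noncomputable def JL (i : ℕ) (m : ℤ) : Module.End ℂ (FSp n) :=
  ∑ k ∈ Finset.Ico 1 i, NL n r k (i - 1) k (i - 1) m - ∑ k ∈ Finset.Icc 1 i, NL n r k i k i m

/-- Normal ordering of `a*_{ii,s}` against an endomorphism. -/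
noncomputable def starL (i : ℕ) (s : ℤ) (B : Module.End ℂ (FSp n)) : Module.End ℂ (FSp n) :=
  if (i ≤ r ∧ 0 < s) ∨ r < i then B * sL n r i i s else sL n r i i s * B

/-- The modes of the cubic part of `ρ(E_i)`. -/
noncomputable def QL (i : ℕ) (m : ℤ) : Module.End ℂ (FSp n) :=
  lsum fun s => starL n r i s (JL n r i (m - s))

/-- The modes of `a*_{ii}(z) b_i(z)`. -/
noncomputable def sbL (e : ℕ → ℕ → ℂ) (lam : ℕ → ℂ) (i : ℕ) (m : ℤ) : Module.End ℂ (FSp n) :=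
  lsum fun s => sL n r i i s * bL n e lam i (m - s)

/-- The modes of `a*_{ab}(z) a*_{xy}(z)`. -/
noncomputable def PL (a b x y : ℕ) (m : ℤ) : Module.End ℂ (FSp n) :=
  lsum fun s => sX n r a b s * sX n r x y (m - s)

/-- The level of the derivative term in `ρ(E_i)`. -/
noncomputable def kap (r : ℕ) (γ : ℂ) (i : ℕ) : ℂ :=
  (if r < i then (r : ℂ) + 1 else (i : ℂ) + 1) - γ ^ 2

/-- The operator `ρ(E_i)_m` as an endomorphism. -/
noncomputable def EL (γ : ℂ) (e : ℕ → ℕ → ℂ) (lam : ℕ → ℂ) (i : ℕ) (m : ℤ) :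
    Module.End ℂ (FSp n) :=
  QL n r i m + ∑ k ∈ Finset.Icc (i + 1) n, NL n r (i + 1) k i k m
    - ∑ k ∈ Finset.Ico 1 i, NL n r k (i - 1) k i m - sbL n r e lam i m
    - (kap r γ i * -(m : ℂ)) • sL n r i i m

variable {n r}

theorem LF.sum_NL_coe (x y p q : ℕ) (hyq : y ≤ q) (m : ℤ) (hne : ¬(x = p ∧ y = q)) (z : FSp n) :
    NL n r x y p q m z = ∑ᶠ s : ℤ, aop n r x y s (astarop n r p q (m - s) z) := by
  rw [NL, lsum_apply (lf_nAAL hyq m)]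
  refine finsum_congr fun s => ?_
  rw [nAAL_of_ne hne, Module.End.mul_apply, aL_coe, sL_coe]

theorem NL_coe (x y : ℕ) (m : ℤ) : ⇑(NL n r x y x y m) = nAAmode n r x y x y m := by
  funext z
  rw [NL, lsum_apply (lf_nAAL le_rfl m), nAAmode]
  refine finsum_congr fun s => ?_
  unfold nAAL nAA
  split_ifs <;> rw [Module.End.mul_apply, aL_coe, sL_coe]

theorem vanTop_J {i : ℕ} (hi : i ≤ r) : VanTop (JL n r i) :=
  (VanTop.sum _ fun k _ => vanTop_N (by omega)).sub (VanTop.sum _ fun k _ => vanTop_N hi)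

theorem lf_starL_J (i : ℕ) (m : ℤ) : LF fun s => starL n r i s (JL n r i (m - s)) := by
  by_cases hi : i ≤ r
  · refine LF.of_van ((vanTop_s (n := n) (r := r) i i).congr_large 0 fun s z hs h => ?_)
      ((vanTop_J (n := n) hi).congr_small m 0 fun s z hs h => ?_)
    · rw [starL, if_pos (Or.inl ⟨hi, hs⟩), Module.End.mul_apply, h, map_zero]
    · rw [starL, if_neg (by omega), Module.End.mul_apply, h, map_zero]
  · have h0 : LF (sL n r i i) := LF.of_van (vanTop_s i i) (vanBot_s (by omega))
    refine (h0.mul_left fun s => JL n r i (m - s)).of_le fun s z h => ?_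
    rwa [starL, if_pos (Or.inr (by omega))]

theorem lf_sb (e : ℕ → ℕ → ℂ) (lam : ℕ → ℂ) (i : ℕ) (m : ℤ) :
    LF fun s => sL n r i i s * bL n e lam i (m - s) :=
  LF.of_vanTop (vanTop_s i i) (vanTop_b e lam i) fun _ => lie_s_b _ _ _ _ _ _ _

theorem lf_P (a b x y : ℕ) (m : ℤ) : LF fun s => sX n r a b s * sX n r x y (m - s) :=
  LF.of_vanTop (vanTop_sX a b) (vanTop_sX x y) fun _ => lie_sX_sX _ _ _ _ _ _

theorem EL_coe (γ : ℂ) (e : ℕ → ℕ → ℂ) (lam : ℕ → ℂ) (i : ℕ) (m : ℤ) :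
    ⇑(EL n r γ e lam i m) = rhoE n r γ e lam i m := by
  have hJ (t : ℤ) : ⇑(JL n r i t) = (∑ k ∈ Finset.Ico 1 i, nAAmode n r k (i - 1) k (i - 1) t)
      - ∑ k ∈ Finset.Icc 1 i, nAAmode n r k i k i t := by
    funext z
    simp only [JL, LinearMap.sub_apply, LinearMap.sum_apply, Pi.sub_apply, Finset.sum_apply,
      NL_coe]
  funext q
  simp only [EL, LinearMap.sub_apply, LinearMap.add_apply, LinearMap.sum_apply,
    LinearMap.smul_apply, rhoE, QL, sbL, lsum_apply (lf_starL_J i m),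
    lsum_apply (lf_sb e lam i m), Module.End.mul_apply, sL_coe, bL_coe, kap, smul_smul]
  congr 1
  congr 1
  congr 1
  · congr 1
    · refine finsum_congr fun s => ?_
      rw [← hJ, starL, nStar]
      split_ifs <;> rw [Module.End.mul_apply, sL_coe]
    · exact Finset.sum_congr rfl fun k _ => LF.sum_NL_coe _ _ _ _ le_rfl _ (by omega) _
  · refine Finset.sum_congr rfl fun k hk => LF.sum_NL_coe _ _ _ _ (by omega) _ ?_ _
    have := Finset.mem_Ico.1 hk
    omega

/-- Coefficient of the action of `JL` on `a*_{xy}`. -/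
def cJ (i y : ℕ) : ℂ := (if y + 1 = i then 1 else 0) - if y = i then 1 else 0

theorem lie_J_a {i : ℕ} (hin : i ≤ n) {x y : ℕ} (hxy : x ≤ y) (m u : ℤ) :
    ⁅JL n r i m, aL n r x y u⁆ = -cJ i y • aL n r x y (m + u) := by
  by_cases h : Root n x y
  · obtain ⟨h1, h2, h3⟩ := id h
    rw [JL, sub_lie, sum_lie, sum_lie]
    simp only [lie_N_a le_rfl h, ite_and, Finset.sum_ite_eq', Finset.mem_Icc, Finset.mem_Ico, cJ]
    by_cases hi : y = i
    · subst hi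
      have e1 : ¬y - 1 = y := by omega
      simp only [e1, h1, h2, if_true, if_false, ite_self, Nat.add_eq_left, one_ne_zero]
      module
    · by_cases hi' : y + 1 = i
      · subst hi'
        have e3 : 1 ≤ x ∧ x < y + 1 := by omega
        simp only [e3, if_true, if_false, hi, Ne.symm hi, Nat.add_sub_cancel, ite_self]
        module
      · have e1 : 1 ≤ x → x < i → ¬ i - 1 = y := by omega
        simp only [hi', hi, Ne.symm hi, if_false]
        split_ifs <;> first | omega | simp
  · rw [aL_of_not_root h, aL_of_not_root h, lie_zero, smul_zero]

theorem lie_J_sX {i : ℕ} (hin : i ≤ n) {x y : ℕ} (hxy : x ≤ y) (m u : ℤ) :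
    ⁅JL n r i m, sX n r x y u⁆ = cJ i y • sX n r x y (m + u) := by
  rw [← sL_eq_sX hxy, ← sL_eq_sX hxy]
  by_cases h : Root n x y
  · obtain ⟨h1, h2, h3⟩ := id h
    rw [JL, sub_lie, sum_lie, sum_lie]
    simp only [lie_N_s le_rfl h, ite_and, Finset.sum_ite_eq', Finset.mem_Icc, Finset.mem_Ico, cJ]
    by_cases hi : y = i
    · subst hi
      have e1 : ¬y - 1 = y := by omega
      simp only [e1, h1, h2, if_true, if_false, ite_self, Nat.add_eq_left, one_ne_zero]
      module
    · by_cases hi' : y + 1 = i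
      · subst hi'
        have e3 : 1 ≤ x ∧ x < y + 1 := by omega
        simp only [e3, if_true, if_false, hi, Ne.symm hi, Nat.add_sub_cancel, ite_self]
        module
      · have e1 : 1 ≤ x → x < i → ¬ i - 1 = y := by omega
        simp only [hi', hi, Ne.symm hi, if_false]
        split_ifs <;> first | omega | simp
  · rw [sL_of_not_root h, sL_of_not_root h, lie_zero, smul_zero]

theorem lie_J_h (i : ℕ) (k : Fin n) (m u : ℤ) : ⁅JL n r i m, hL n k u⁆ = 0 := by
  rw [JL, sub_lie, sum_lie, sum_lie]
  simp only [lie_N_h le_rfl, Finset.sum_const_zero, sub_zero]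

theorem lie_euler_J (H : ℕ → ℂ) (i : ℕ) (m : ℤ) : ⁅euler (wt n r H), JL n r i m⁆ = 0 := by
  rw [JL, lie_sub, lie_sum, lie_sum]
  simp only [lie_euler_N le_rfl, sub_self, zero_smul, Finset.sum_const_zero]

theorem vev_J (i : ℕ) (m : ℤ) : vev (JL n r i m) = 0 := by
  rw [JL, vev_sub, vev_sum, vev_sum]
  simp only [vev_N le_rfl, Finset.sum_const_zero, sub_zero]

theorem starL_zero (i : ℕ) (s : ℤ) : starL n r i s 0 = 0 := by
  unfold starL
  split_ifs <;> simp

theorem starL_smul (i : ℕ) (s : ℤ) (c : ℂ) (B : Module.End ℂ (FSp n)) :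
    starL n r i s (c • B) = c • starL n r i s B := by
  unfold starL
  split_ifs <;> simp

theorem lie_starL {i : ℕ} {s : ℤ} {X : Module.End ℂ (FSp n)} {c : ℂ}
    (h : ⁅sL n r i i s, X⁆ = c • 1) (B : Module.End ℂ (FSp n)) :
    ⁅starL n r i s B, X⁆ = starL n r i s ⁅B, X⁆ + c • B := by
  unfold starL
  split_ifs <;> rw [mul_lie, h]
  · rw [mul_smul_comm, mul_one, add_comm]
  · rw [smul_mul_assoc, one_mul]

theorem lie_starL_of_commute {i : ℕ} {s : ℤ} {X : Module.End ℂ (FSp n)}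
    (h : ⁅sL n r i i s, X⁆ = 0) (B : Module.End ℂ (FSp n)) :
    ⁅starL n r i s B, X⁆ = starL n r i s ⁅B, X⁆ := by
  rw [lie_starL (c := 0) (by rw [h, zero_smul]), zero_smul, add_zero]

theorem starL_of_commute {i : ℕ} {s : ℤ} {X : Module.End ℂ (FSp n)}
    (h : ⁅sL n r i i s, X⁆ = 0) : starL n r i s X = sL n r i i s * X := by
  unfold starL
  split_ifs
  · exact (sub_eq_zero.1 ((LieRing.of_associative_ring_bracket _ _).symm.trans h)).symm
  · rfl

theorem vev_starL_a (i : ℕ) (s t : ℤ) (x y : ℕ) : vev (starL n r i s (aL n r x y t)) = 0 := by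
  unfold starL sL
  split_ifs <;> first | omega | simp [vev_mX_mul, vev_mul_neg_dX, vev_zero]

theorem lie_Q_sX {i : ℕ} (hin : i ≤ n) {x y : ℕ} (hxy : x ≤ y + 1) (m u : ℤ) :
    ⁅QL n r i m, sX n r x y u⁆ = if x ≤ y then cJ i y • PL n r i i x y (m + u) else 0 := by
  split_ifs with h
  · rw [QL, lsum_lie (lf_starL_J i m), PL, smul_lsum (lf_P _ _ _ _ _)]
    congr 1
    funext s
    have hc (w : ℤ) : ⁅sL n r i i s, sX n r x y w⁆ = 0 := by
      rw [sL_eq_sX le_rfl, lie_sX_sX]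
    rw [lie_starL_of_commute (hc u), lie_J_sX hin h, starL_smul, starL_of_commute (hc _),
      sL_eq_sX le_rfl, sub_add_eq_add_sub]
  · obtain rfl : x = y + 1 := by omega
    rw [sX_succ]
    split_ifs <;> simp [bracket_one]

theorem lie_Q_h (i : ℕ) (k : Fin n) (m u : ℤ) : ⁅QL n r i m, hL n k u⁆ = 0 := by
  rw [QL, lsum_lie (lf_starL_J i m)]
  simp only [lie_starL_of_commute (lie_s_h _ _ _ _ _), lie_J_h, starL_zero, lsum_zero]

theorem lie_euler_b (H : ℕ → ℂ) (e : ℕ → ℕ → ℂ) (lam : ℕ → ℂ) (i : ℕ) (m : ℤ) :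
    ⁅euler (wt n r H), bL n e lam i m⁆ = 0 :=
  lie_b_of_lie_h fun k => lie_euler_h H k m

theorem lie_euler_Q (H : ℕ → ℂ) (i : ℕ) (m : ℤ) :
    ⁅euler (wt n r H), QL n r i m⁆ = (H (i + 1) - H i) • QL n r i m := by
  rw [QL, lie_lsum (lf_starL_J i m), smul_lsum (lf_starL_J i m)]
  congr 1
  funext u
  unfold starL
  split_ifs <;> rw [lie_mul, lie_euler_J, lie_euler_s] <;> simp

theorem lie_euler_sb (H : ℕ → ℂ) (e : ℕ → ℕ → ℂ) (lam : ℕ → ℂ) (i : ℕ) (m : ℤ) :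
    ⁅euler (wt n r H), sbL n r e lam i m⁆ = (H (i + 1) - H i) • sbL n r e lam i m := by
  rw [sbL, lie_lsum (lf_sb e lam i m), smul_lsum (lf_sb e lam i m)]
  congr 1
  funext u
  rw [lie_mul, lie_euler_b, lie_euler_s]
  simp

theorem lie_sb_sX (e : ℕ → ℕ → ℂ) (lam : ℕ → ℂ) (i x y : ℕ) (m u : ℤ) :
    ⁅sbL n r e lam i m, sX n r x y u⁆ = 0 := by
  rw [sbL, lsum_lie (lf_sb e lam i m)]
  convert lsum_zero (M := FSp n) using 3 with s
  have h : ⁅bL n e lam i (m - s), sX n r x y u⁆ = 0 := by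
    unfold sX
    split_ifs <;> simp [bracket_one, lie_b_s]
  rw [mul_lie, h, sL_eq_sX le_rfl, lie_sX_sX]
  simp

theorem lie_sb_h (e : ℕ → ℕ → ℂ) (lam : ℕ → ℂ) (i : ℕ) (k : Fin n) (m u : ℤ) :
    ⁅sbL n r e lam i m, hL n k u⁆ = (-(u * e i (k.1 + 1))) • sX n r i i (m + u) := by
  rw [sbL, lsum_lie (lf_sb e lam i m)]
  convert lsum_single (M := FSp n) (m + u)
    fun _ => (-(u * e i (k.1 + 1))) • sX n r i i (m + u) using 3 with s
  rw [mul_lie, lie_s_h, lie_b_h, zero_mul, add_zero]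
  by_cases h : s = m + u
  · subst h
    rw [if_pos (by ring), if_pos rfl, mul_smul_comm, mul_one, sL_eq_sX le_rfl]
    congr 1
    push_cast
    ring
  · rw [if_neg (by omega), if_neg h, mul_zero]

theorem lie_sb_a {i : ℕ} (hi : Root n i i) (e : ℕ → ℕ → ℂ) (lam : ℕ → ℂ) (x y : ℕ) (m u : ℤ) :
    ⁅sbL n r e lam i m, aL n r x y u⁆ =
      if x = i ∧ y = i then -bL n e lam i (m + u) else 0 := by
  by_cases hxy : Root n x y
  · rw [sbL, lsum_lie (lf_sb e lam i m)]
    by_cases hc : x = i ∧ y = i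
    · rw [if_pos hc]
      convert lsum_single (M := FSp n) (-u) fun s => -bL n e lam i (m - s) using 3 with s
      · rw [mul_lie, lie_b_a, lie_s_a hxy, mul_zero, zero_add]
        by_cases h : s = -u
        · rw [if_pos ⟨hc.1, hc.2, by omega⟩, if_pos h]
          exact LinearMap.ext fun z => by simp
        · rw [if_neg (by omega), if_neg h, zero_mul]
      · ring
    · rw [if_neg hc]
      convert lsum_zero (M := FSp n) using 3 with s
      rw [mul_lie, lie_b_a, lie_s_a hxy, if_neg (by tauto)]
      simp
  · rw [aL_of_not_root hxy, lie_zero, if_neg]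
    rintro ⟨rfl, rfl⟩
    exact hxy hi

end EOperators

section Actions

variable {n r : ℕ}

theorem PL_succ_right (a b y : ℕ) (m : ℤ) : PL n r a b (y + 1) y m = sX n r a b m := by
  rw [PL]
  convert lsum_single (M := FSp n) m fun s => sX n r a b s using 3 with s
  rw [sX_succ, mul_ite, mul_one, mul_zero]
  exact if_congr (by omega) rfl rfl

theorem PL_succ_left (b x y : ℕ) (m : ℤ) : PL n r (b + 1) b x y m = sX n r x y m := by
  rw [PL]
  convert lsum_single (M := FSp n) 0 fun s => sX n r x y (m - s) using 3 with s
  · rw [sX_succ, ite_mul, one_mul, zero_mul]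
  · rw [sub_zero]

theorem lie_F_P {k : ℕ} (hk : 1 ≤ k) (hkn : k ≤ n) (a b x y : ℕ) (u m : ℤ) :
    ⁅FL n r k u, PL n r a b x y m⁆ =
      (if a = k then PL n r (k + 1) b x y (u + m) else 0) +
        if x = k then PL n r a b (k + 1) y (u + m) else 0 := by
  have h2 : LF fun s => (if x = k then sX n r a b s * sX n r (k + 1) y (u + m - s) else 0) := by
    split_ifs
    · exact lf_P _ _ _ _ _
    · exact (lf_P (n := n) (r := r) a b x y m).of_le fun s q _ => rfl
  have h1 : LF fun s => (if a = k then sX n r (k + 1) b (u + s) * sX n r x y (m - s) else 0) := by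
    split_ifs
    · convert (lf_P (k + 1) b x y (u + m)).shift u using 4 with s
      ring
    · exact (lf_P (n := n) (r := r) a b x y m).of_le fun s q _ => rfl
  have e2 : (lsum fun s => (if x = k then sX n r a b s * sX n r (k + 1) y (u + m - s) else 0)) =
      if x = k then PL n r a b (k + 1) y (u + m) else 0 := by
    split_ifs
    · rfl
    · exact lsum_zero
  have e1 : (lsum fun s => (if a = k then sX n r (k + 1) b (u + s) * sX n r x y (m - s) else 0)) =
      if a = k then PL n r (k + 1) b x y (u + m) else 0 := by
    split_ifs
    · rw [PL, ← lsum_shift (lf_P _ _ _ _ _) u]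
      congr 1
      funext s
      congr 2
      ring
    · exact lsum_zero
  rw [← e1, ← e2, lsum_add h1 h2, PL, lie_lsum (lf_P _ _ _ _ _)]
  congr 1
  funext s
  rw [lie_mul, lie_F_sX hk hkn, lie_F_sX hk hkn, mul_ite, ite_mul, mul_zero, zero_mul, add_comm,
    add_sub_assoc]

variable {γ : ℂ} {e : ℕ → ℕ → ℂ} {lam : ℕ → ℂ}

theorem lie_E_sX {i : ℕ} (hi : 1 ≤ i) (hin : i ≤ n) {x y : ℕ} (hxy : x ≤ y + 1) (m u : ℤ) :
    ⁅EL n r γ e lam i m, sX n r x y u⁆ = cJ i y • PL n r i i x y (m + u)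
      + (if x = i + 1 then sX n r i y (m + u) else 0)
      - if y + 1 = i then sX n r x i (m + u) else 0 := by
  by_cases h : x ≤ y
  · have h1 : ∀ k ∈ Finset.Icc (i + 1) n, ⁅NL n r (i + 1) k i k m, sX n r x y u⁆ =
        if k = y then (if x = i + 1 then sL n r i k (m + u) else 0) else 0 := fun k hk => by
      have hk := Finset.mem_Icc.1 hk
      rw [lie_N_sX le_rfl ⟨by omega, hk⟩]
      split_ifs <;> first | rfl | omega
    have h2 : ∀ k ∈ Finset.Ico 1 i, ⁅NL n r k (i - 1) k i m, sX n r x y u⁆ =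
        if k = x then (if y + 1 = i then sL n r k i (m + u) else 0) else 0 := fun k hk => by
      have hk := Finset.mem_Ico.1 hk
      rw [lie_N_sX (by omega) ⟨hk.1, by omega, by omega⟩]
      split_ifs <;> first | rfl | omega
    have h3 : ⁅sL n r i i m, sX n r x y u⁆ = 0 := by rw [sL_eq_sX le_rfl, lie_sX_sX]
    rw [EL, sub_lie, sub_lie, sub_lie, add_lie, lie_Q_sX hin hxy, if_pos h, sum_lie, sum_lie,
      Finset.sum_congr rfl h1, Finset.sum_congr rfl h2, lie_sb_sX, smul_bracket, h3, smul_zero,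
      sub_zero, sub_zero, Finset.sum_ite_eq', Finset.sum_ite_eq']
    refine congrArg₂ _ (congrArg₂ _ rfl ?_) ?_
    · split_ifs with h4 h5 h5
      · exact sL_eq_sX (by have := Finset.mem_Icc.1 h4; omega) _
      · rfl
      · rw [← sL_eq_sX (by omega), sL_of_not_root]
        intro h6
        exact h4 (Finset.mem_Icc.2 ⟨by omega, h6.2.2⟩)
      · rfl
    · split_ifs with h4 h5 h5
      · exact sL_eq_sX (by omega) _
      · rfl
      · rw [← sL_eq_sX (by omega), sL_of_not_root]
        intro h6
        exact h4 (Finset.mem_Ico.2 ⟨h6.1, by omega⟩)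
      · rfl
  · obtain rfl : x = y + 1 := by omega
    have h0 : ⁅EL n r γ e lam i m, sX n r (y + 1) y u⁆ = 0 := by
      rw [sX_succ]
      split_ifs <;> simp [bracket_one]
    rw [h0, PL_succ_right, cJ]
    by_cases hy : y = i
    · subst hy
      simp
      module
    · by_cases hy' : y + 1 = i
      · subst hy'
        simp
      · simp [hy, hy']

theorem lie_E_h (i : ℕ) (k : Fin n) (m u : ℤ) :
    ⁅EL n r γ e lam i m, hL n k u⁆ = (u * e i (k.1 + 1)) • sX n r i i (m + u) := by
  rw [EL, sub_lie, sub_lie, sub_lie, add_lie, lie_Q_h, sum_lie, sum_lie, lie_sb_h, smul_bracket,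
    lie_s_h, smul_zero, sub_zero, zero_add]
  simp only [lie_N_h le_rfl, lie_N_h (Nat.sub_le i 1), Finset.sum_const_zero]
  module

theorem lie_euler_E (H : ℕ → ℂ) {i : ℕ} (hi : 1 ≤ i) (m : ℤ) :
    ⁅euler (wt n r H), EL n r γ e lam i m⁆ = (H (i + 1) - H i) • EL n r γ e lam i m := by
  rw [EL, lie_sub, lie_sub, lie_sub, lie_add, lie_euler_Q, lie_euler_sb, bracket_smul, lie_euler_s,
    lie_sum, lie_sum, Finset.sum_congr rfl fun k _ => lie_euler_N le_rfl H m,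
    Finset.sum_congr rfl fun k _ => lie_euler_N (Nat.sub_le i 1) H m]
  simp only [Nat.sub_add_cancel hi, smul_sub, smul_add, Finset.smul_sum, smul_smul]
  refine congrArg₂ _ (congrArg₂ _ (congrArg₂ _ (congrArg₂ _ rfl ?_) ?_) rfl) ?_
  · refine Finset.sum_congr rfl fun k _ => ?_
    congr 1
    ring
  · refine Finset.sum_congr rfl fun k _ => ?_
    congr 1
    ring
  · rw [mul_comm]

/-- The double commutators of `ρ(E_i)` with the operators `a_{xy}`. -/
theorem lie_E_a_a {i : ℕ} (hi : 1 ≤ i) (hin : i ≤ n) {x y p q : ℕ} (hxy : Root n x y)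
    (hpq : Root n p q) (m u v : ℤ) :
    ⁅⁅EL n r γ e lam i m, aL n r x y u⁆, aL n r p q v⁆ =
      (if x = i ∧ y = i then cJ i q • aL n r p q (m + u + v) else 0)
      + if p = i ∧ q = i then cJ i y • aL n r x y (m + u + v) else 0 := by
  have hii : Root n i i := ⟨hi, le_rfl, hin⟩
  have hQ : ⁅⁅QL n r i m, aL n r x y u⁆, aL n r p q v⁆ =
      (if x = i ∧ y = i then cJ i q • aL n r p q (m + u + v) else 0)
      + if p = i ∧ q = i then cJ i y • aL n r x y (m + u + v) else 0 := by
    rw [QL, lsum_lie (lf_starL_J i m), lsum_lie ((lf_starL_J i m).lie' _)]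
    have e1 := lsum_single (M := FSp n) (-u) fun s =>
      if x = i ∧ y = i then cJ i q • aL n r p q (m - s + v) else 0
    have e2 := lsum_single (M := FSp n) (-v) fun s =>
      if p = i ∧ q = i then cJ i y • aL n r x y (m - s + u) else 0
    rw [show m - -u + v = m + u + v by ring] at e1
    rw [show m - -v + u = m + u + v by ring] at e2
    rw [← e1, ← e2, lsum_add (lf_single _ _) (lf_single _ _)]
    congr 1
    funext s
    have h1 : ⁅sL n r i i s, aL n r x y u⁆ =
        (if s = -u then (if x = i ∧ y = i then (-1 : ℂ) else 0) else 0) • 1 := by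
      rw [lie_s_a hxy]
      split_ifs <;> first | omega | module
    have h2 : ⁅sL n r i i s, aL n r p q v⁆ =
        (if s = -v then (if p = i ∧ q = i then (-1 : ℂ) else 0) else 0) • 1 := by
      rw [lie_s_a hpq]
      split_ifs <;> first | omega | module
    rw [lie_starL h1, lie_J_a hin hxy.2.1, starL_smul, add_lie, smul_bracket, smul_bracket,
      lie_starL h2, lie_a_a, starL_zero, lie_J_a hin hpq.2.1]
    split_ifs <;> module
  have h1 : ∀ k ∈ Finset.Icc (i + 1) n,
      ⁅⁅NL n r (i + 1) k i k m, aL n r x y u⁆, aL n r p q v⁆ = 0 := fun k hk => by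
    rw [lie_N_a le_rfl hxy]
    split_ifs <;> simp [lie_a_a]
  have h2 : ∀ k ∈ Finset.Ico 1 i,
      ⁅⁅NL n r k (i - 1) k i m, aL n r x y u⁆, aL n r p q v⁆ = 0 := fun k hk => by
    rw [lie_N_a (by omega) hxy]
    split_ifs <;> simp [lie_a_a]
  have h3 : ⁅⁅sbL n r e lam i m, aL n r x y u⁆, aL n r p q v⁆ = 0 := by
    rw [lie_sb_a hii]
    split_ifs <;> simp [lie_b_a]
  have h4 : ⁅⁅sL n r i i m, aL n r x y u⁆, aL n r p q v⁆ = 0 := by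
    rw [lie_s_a hxy]
    split_ifs <;> simp [one_bracket]
  rw [EL]
  simp only [sub_lie, add_lie, sum_lie, smul_bracket, hQ, h3, h4, Finset.sum_congr rfl h1,
    Finset.sum_congr rfl h2, Finset.sum_const_zero, smul_zero, sub_zero, add_zero]

/-- The weight of the root labelled by `(x, y)` on the `i`-th coroot. -/
def cH (i x y : ℕ) : ℂ :=
  (if x = i then 1 else 0) - (if x = i + 1 then 1 else 0)
    + (if y = i then 1 else 0) - if y + 1 = i then 1 else 0

variable (n r e lam) in
/-- The modes of the Cartan currents, written over all positive roots. -/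
noncomputable def HL (i : ℕ) (m : ℤ) : Module.End ℂ (FSp n) :=
  ∑ x ∈ Finset.Icc 1 n, ∑ y ∈ Finset.Icc x n, cH i x y • NL n r x y x y m + bL n e lam i m

theorem lie_H_a (i x y : ℕ) (m u : ℤ) :
    ⁅HL n r e lam i m, aL n r x y u⁆ = -cH i x y • aL n r x y (m + u) := by
  by_cases h : Root n x y
  · rw [HL, add_lie, lie_b_a, add_zero, sum_lie]
    simp only [sum_lie, smul_bracket, lie_N_a le_rfl h, ite_and, smul_ite, smul_zero]
    rw [Finset.sum_eq_single x, Finset.sum_eq_single y]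
    · simp only [if_true]
      module
    · intro b _ hb
      simp [hb]
    · intro hc
      exact absurd (Finset.mem_Icc.2 h.2) hc
    · intro b _ hb
      simp [hb]
    · intro hc
      exact absurd (Finset.mem_Icc.2 ⟨h.1, h.2.1.trans h.2.2⟩) hc
  · rw [aL_of_not_root h, aL_of_not_root h, lie_zero, smul_zero]

theorem lie_H_sX (i x y : ℕ) (m u : ℤ) :
    ⁅HL n r e lam i m, sX n r x y u⁆ = cH i x y • sX n r x y (m + u) := by
  by_cases hxy : x = y + 1
  · subst hxy
    have : cH i (y + 1) y = 0 := by simp [cH]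
    rw [this, zero_smul, sX_succ]
    split_ifs <;> simp [bracket_one]
  simp only [sX, hxy, if_false]
  by_cases h : Root n x y
  · rw [HL, add_lie, lie_b_s, add_zero, sum_lie]
    simp only [sum_lie, smul_bracket, lie_N_s le_rfl h, ite_and, smul_ite, smul_zero]
    rw [Finset.sum_eq_single x, Finset.sum_eq_single y]
    · simp
    · intro b _ hb
      simp [hb]
    · intro hc
      exact absurd (Finset.mem_Icc.2 h.2) hc
    · intro b _ hb
      simp [hb]
    · intro hc
      exact absurd (Finset.mem_Icc.2 ⟨h.1, h.2.1.trans h.2.2⟩) hc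
  · rw [sL_of_not_root h, sL_of_not_root h, lie_zero, smul_zero]

theorem lie_H_h (i : ℕ) (k : Fin n) (m u : ℤ) :
    ⁅HL n r e lam i m, hL n k u⁆ = if m + u = 0 then ((m : ℂ) * e i (k.1 + 1)) • 1 else 0 := by
  rw [HL, add_lie, lie_b_h, sum_lie]
  simp only [sum_lie, smul_bracket, lie_N_h le_rfl, smul_zero, Finset.sum_const_zero, zero_add]

theorem lie_euler_H (H : ℕ → ℂ) (i : ℕ) (m : ℤ) :
    ⁅euler (wt n r H), HL n r e lam i m⁆ = 0 := by
  rw [HL, lie_add, lie_euler_b, lie_sum]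
  simp only [lie_sum, bracket_smul, lie_euler_N le_rfl, sub_self, zero_smul, smul_zero,
    Finset.sum_const_zero, zero_add]

theorem lie_H_F {i k : ℕ} (hk : 1 ≤ k) (hkn : k ≤ n) (m u : ℤ) :
    ⁅HL n r e lam i m, FL n r k u⁆ = -cH i k k • FL n r k (m + u) := by
  rw [← sub_eq_zero]
  refine eq_zero_of_commute (r := r) (fun x => (x : ℂ)) (w := -1) ?_ ?_ ?_ ?_ (by norm_num)
  · intro x y v
    simp only [sub_lie, lie_lie, smul_bracket, lie_H_a, lie_F_a hk, bracket_ite_zero, bracket_smul,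
      lie_neg]
    split_ifs with h
    · obtain ⟨rfl, h⟩ := h
      have : cH i k y - cH i k k - cH i (k + 1) y = 0 := by
        simp only [cH, Nat.add_right_cancel_iff]
        ring
      have h2 : cH i k y = cH i k k + cH i (k + 1) y := by linear_combination this
      rw [h2, show m + (u + v) = m + u + v by ring, show u + (m + v) = m + u + v by ring]
      module
    · simp
  · intro x y v
    simp only [sub_lie, lie_lie, smul_bracket, lie_H_sX, lie_F_sX hk hkn, bracket_ite_zero,
      bracket_smul]
    split_ifs with h
    · subst h
      have h2 : cH i x y = cH i x x + cH i (x + 1) y := by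
        simp only [cH, Nat.add_right_cancel_iff]
        ring
      rw [h2, show m + (u + v) = m + u + v by ring, show u + (m + v) = m + u + v by ring]
      module
    · simp
  · intro l v
    simp only [sub_lie, lie_lie, smul_bracket, lie_H_h, lie_F_h, lie_zero]
    split_ifs <;> simp [bracket_smul, bracket_one]
  · have h1 (v : ℤ) : ⁅euler (wt n r fun x => (x : ℂ)), FL n r k v⁆ = (-1 : ℂ) • FL n r k v := by
      rw [lie_euler_F]
      push_cast
      congr 1
      ring
    rw [lie_sub, leibniz_lie, lie_euler_H, bracket_smul, h1, h1, bracket_smul, smul_sub, zero_lie]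
    module

end Actions

section Level

variable {n r : ℕ}

theorem lie_N_of_commute {x y p q : ℕ} (hyq : y ≤ q) {T : Module.End ℂ (FSp n)}
    (ha : ∀ u, ⁅T, aL n r x y u⁆ = 0) (hs : ∀ u, ⁅T, sL n r p q u⁆ = 0) (m : ℤ) :
    ⁅T, NL n r x y p q m⁆ = 0 := by
  rw [NL, lie_lsum (lf_nAAL hyq m)]
  convert lsum_zero (M := FSp n) using 3 with u
  unfold nAAL
  split_ifs <;> simp only [lie_mul, ha, hs, mul_zero, zero_mul, add_zero]

/-- The pair `a_{xy,u} a*_{xy,v}`, normally ordered with respect to the threshold `θ`. -/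
noncomputable def nThr (n r : ℕ) (θ : ℤ) (x y : ℕ) (u v : ℤ) : Module.End ℂ (FSp n) :=
  if θ ≤ u ∧ y ≤ r then sL n r x y v * aL n r x y u else aL n r x y u * sL n r x y v

theorem nThr_zero (x y : ℕ) (u v : ℤ) : nThr n r 0 x y u v = nAAL n r x y x y u v := rfl

theorem nThr_succ {x y : ℕ} (h : Root n x y) (θ m u : ℤ) :
    nThr n r (θ + 1) x y u (m - u) = nThr n r θ x y u (m - u)
      + if u = θ then (if y ≤ r ∧ m = 0 then 1 else 0) else 0 := by
  have h1 := lie_a_s (r := r) h x y u (m - u)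
  have h2 : aL n r x y u * sL n r x y (m - u) = sL n r x y (m - u) * aL n r x y u +
      if m = 0 then 1 else 0 := by
    rw [Ring.lie_def, sub_eq_iff_eq_add'] at h1
    rw [h1]
    simp
  unfold nThr
  split_ifs <;> first | omega | simp_all

theorem lf_nThr {x y : ℕ} (h : Root n x y) (θ m : ℤ) :
    LF fun u => nThr n r θ x y u (m - u) := by
  induction θ with
  | zero => exact lf_nAAL le_rfl m
  | succ k hk =>
    simp only [nThr_succ h]
    exact hk.add (lf_single _ fun _ => _)
  | pred k hk =>
    have := hk.sub (lf_single (M := FSp n) (-(k : ℤ) - 1)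
      fun _ => if y ≤ r ∧ m = 0 then 1 else 0)
    convert this using 2 with u
    rw [eq_sub_iff_add_eq, ← nThr_succ h, sub_add_cancel]

theorem lsum_nThr {x y : ℕ} (h : Root n x y) (θ m : ℤ) :
    (lsum fun u => nThr n r θ x y u (m - u)) =
      NL n r x y x y m + if y ≤ r ∧ m = 0 then (θ : ℂ) • 1 else 0 := by
  have key (k : ℤ) : (lsum fun u => nThr n r (k + 1) x y u (m - u)) =
      (lsum fun u => nThr n r k x y u (m - u)) + if y ≤ r ∧ m = 0 then 1 else 0 := by
    simp only [nThr_succ h]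
    rw [← lsum_add (lf_nThr h k m) (lf_single _ fun _ => _),
      lsum_single k fun _ => if y ≤ r ∧ m = 0 then 1 else 0]
  induction θ with
  | zero => simp [nThr_zero, NL]
  | succ k hk =>
    rw [key, hk]
    split_ifs
    · push_cast
      module
    · simp
  | pred k hk =>
    rw [← sub_add_cancel (-(k : ℤ)) 1, key] at hk
    rw [eq_sub_of_add_eq hk]
    split_ifs
    · push_cast
      module
    · simp

theorem lie_N_N {x y p : ℕ} (hx : Root n x y) (hp : Root n p y) (m w : ℤ) :
    ⁅NL n r x y p y m, NL n r p y x y w⁆ =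
      NL n r p y p y (m + w) - NL n r x y x y (m + w)
        - if y ≤ r ∧ m + w = 0 then (m : ℂ) • 1 else 0 := by
  have e1 := lsum_nThr (r := r) hp 0 (m + w)
  have e2 := lsum_nThr (r := r) hx m (m + w)
  have l1 := lf_nThr (r := r) hp 0 (m + w)
  have l2 := lf_nThr (r := r) hx m (m + w)
  rw [← lsum_shift l2 m] at e2
  rw [Int.cast_zero, zero_smul, ite_self, add_zero] at e1
  rw [sub_sub, ← e1, ← e2, lsum_sub l1 (l2.shift m), NL.eq_def n r p, lie_lsum (lf_nAAL le_rfl w)]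
  congr 1
  funext u
  rw [show m + w - (m + u) = w - u by ring, add_sub_assoc]
  unfold nAAL nThr
  simp only [le_add_iff_nonneg_right]
  split_ifs
  · rw [lie_mul, lie_N_s le_rfl hx, lie_N_a le_rfl hp, if_pos ⟨rfl, rfl⟩, if_pos ⟨rfl, rfl⟩]
    exact LinearMap.ext fun z => by simp [neg_add_eq_sub]
  · rw [lie_mul, lie_N_s le_rfl hx, lie_N_a le_rfl hp, if_pos ⟨rfl, rfl⟩, if_pos ⟨rfl, rfl⟩]
    exact LinearMap.ext fun z => by simp [sub_eq_add_neg]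

variable {e : ℕ → ℕ → ℂ} {lam : ℕ → ℂ}

theorem lie_H_N (i : ℕ) {x y : ℕ} (h : Root n x y) (m p : ℤ) :
    ⁅HL n r e lam i m, NL n r x y x y p⁆ =
      if y ≤ r ∧ m + p = 0 then (-(m * cH i x y)) • 1 else 0 := by
  have hT : ⁅HL n r e lam i m - cH i x y • NL n r x y x y m, NL n r x y x y p⁆ = 0 := by
    refine lie_N_of_commute le_rfl (fun u => ?_) (fun u => ?_) p
    · rw [sub_lie, lie_H_a, smul_bracket, lie_N_a le_rfl h, if_pos ⟨rfl, rfl⟩]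
      module
    · rw [sub_lie, sL_eq_sX h.2.1, lie_H_sX, smul_bracket, ← sL_eq_sX h.2.1, ← sL_eq_sX h.2.1,
        lie_N_s le_rfl h, if_pos ⟨rfl, rfl⟩, sub_self]
  rw [sub_lie, sub_eq_zero] at hT
  rw [hT, smul_bracket, lie_N_N h h, sub_self, zero_sub]
  split_ifs
  · module
  · simp

theorem sum_indicator {y i : ℕ} (hi : 1 ≤ i) :
    ∑ x ∈ Finset.Icc 1 y, ((if x = i then 1 else 0) - (if x = i + 1 then 1 else 0) : ℂ) =
      if i = y then 1 else 0 := by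
  rw [Finset.sum_sub_distrib, Finset.sum_ite_eq', Finset.sum_ite_eq']
  simp only [Finset.mem_Icc]
  split_ifs <;> first | omega | simp

theorem sum_indicator_mul {y i j : ℕ} (hi : 1 ≤ i) (hj : 1 ≤ j) :
    ∑ x ∈ Finset.Icc 1 y, ((if x = i then 1 else 0) - (if x = i + 1 then 1 else 0) : ℂ)
        * ((if x = j then 1 else 0) - (if x = j + 1 then 1 else 0)) =
      if i = j then (if i ≤ y then 1 else 0) + (if i < y then 1 else 0) else
        if i + 1 = j then (if i < y then -1 else 0) else
          if j + 1 = i then (if j < y then -1 else 0) else 0 := by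
  have h (x : ℕ) : ((if x = i then 1 else 0) - (if x = i + 1 then 1 else 0) : ℂ)
        * ((if x = j then 1 else 0) - (if x = j + 1 then 1 else 0)) =
      ((if x = i then (if i = j then 1 else 0) else 0)
        - (if x = i then (if i = j + 1 then 1 else 0) else 0))
        - ((if x = i + 1 then (if i + 1 = j then 1 else 0) else 0)
        - (if x = i + 1 then (if i = j then 1 else 0) else 0)) := by
    split_ifs <;> first | omega | simp
  simp only [h, Finset.sum_sub_distrib, Finset.sum_ite_eq', Finset.mem_Icc]
  split_ifs <;> first | omega | simp

theorem sum_cH (r i j : ℕ) (hi : 1 ≤ i) (hj : 1 ≤ j) :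
    ∑ y ∈ Finset.Icc 1 r, ∑ x ∈ Finset.Icc 1 y, cH i x y * cH j x y =
      cartanEntry i j * ((r + 1) - (if r < i then 1 else 0) * (if r < j then 1 else 0) * (r + 1)
        + (r / 2) * (if i = r + 1 then 1 else 0) * (if j = r + 1 then 1 else 0)) := by
  induction r with
  | zero => simp [show 0 < i by omega, show 0 < j by omega]
  | succ r ih =>
    have h (x : ℕ) : cH i x (r + 1) * cH j x (r + 1) =
        ((if x = i then 1 else 0) - (if x = i + 1 then 1 else 0))
          * ((if x = j then 1 else 0) - (if x = j + 1 then 1 else 0))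
        + ((if r + 1 = j then 1 else 0) - (if r + 2 = j then 1 else 0))
          * ((if x = i then 1 else 0) - (if x = i + 1 then 1 else 0))
        + ((if r + 1 = i then 1 else 0) - (if r + 2 = i then 1 else 0))
          * ((if x = j then 1 else 0) - (if x = j + 1 then 1 else 0))
        + ((if r + 1 = i then 1 else 0) - (if r + 2 = i then 1 else 0))
          * ((if r + 1 = j then 1 else 0) - (if r + 2 = j then 1 else 0)) := by
      rw [cH, cH]
      ring
    rw [Finset.sum_Icc_succ_top (by omega), ih, Finset.sum_congr rfl fun x _ => h x]
    rw [Finset.sum_add_distrib, Finset.sum_add_distrib, Finset.sum_add_distrib, ← Finset.mul_sum,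
      ← Finset.mul_sum, sum_indicator hi, sum_indicator hj, sum_indicator_mul hi hj,
      Finset.sum_const, Nat.card_Icc, Nat.add_sub_cancel, nsmul_eq_mul]
    unfold cartanEntry
    clear ih h
    have hr : (i < r ∨ i = r) ∨ i = r + 1 ∨ r + 2 = i ∨ r + 2 < i := by omega
    rcases eq_or_ne i j with rfl | h1
    · rcases hr with (h2 | h2) | h2 | h2 | h2 <;> simp (disch := omega) only [if_pos, if_neg]
      all_goals push_cast; ring
    · by_cases h2 : i + 1 = j
      · rcases hr with (h3 | h3) | h3 | h3 | h3 <;>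
          simp (disch := omega) only [if_pos, if_neg, h2, true_or]
        all_goals push_cast; ring
      · by_cases h3 : j + 1 = i
        · rcases hr with (h4 | h4) | h4 | h4 | h4 <;>
            simp (disch := omega) only [if_pos, if_neg, h3, or_true]
          all_goals push_cast; ring
        · simp only [h1, h2, h3, or_self, if_false]
          rcases hr with (h4 | h4) | h4 | h4 | h4 <;>
            simp (disch := omega) only [if_pos, if_neg]
          all_goals ring

theorem lie_H_H (γ : ℂ) (hr : r ≤ n)
    (he : ∀ i j, 1 ≤ i → i ≤ n → 1 ≤ j → j ≤ n →
      (∑ k : Fin n, e i (k.1 + 1) * e j (k.1 + 1)) = Bentry r γ i j)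
    {i j : ℕ} (hi : 1 ≤ i) (hin : i ≤ n) (hj : 1 ≤ j) (hjn : j ≤ n) (m p : ℤ) :
    ⁅HL n r e lam i m, HL n r e lam j p⁆ =
      if m + p = 0 then (cartanEntry i j * (γ ^ 2 - (r + 1)) * m) • 1 else 0 := by
  have hb : ⁅HL n r e lam i m, bL n e lam j p⁆ =
      if m + p = 0 then ((m : ℂ) * Bentry r γ i j) • 1 else 0 := by
    rw [HL, add_lie, lie_b_b, he i j hi hin hj hjn]
    simp only [sum_lie, smul_bracket]
    simp [lie_b_of_lie_h fun k => lie_N_h le_rfl k _ _]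
  have hN : ∀ x ∈ Finset.Icc 1 n, ∀ y ∈ Finset.Icc x n,
      ⁅HL n r e lam i m, cH j x y • NL n r x y x y p⁆ =
        ((if y ≤ r then cH i x y * cH j x y else 0) * (if m + p = 0 then -(m : ℂ) else 0)) • 1 := by
    intro x hx y hy
    have hx := Finset.mem_Icc.1 hx
    have hy := Finset.mem_Icc.1 hy
    rw [bracket_smul, lie_H_N i ⟨hx.1, hy⟩]
    split_ifs <;> first | omega | module
  have hs : ∑ x ∈ Finset.Icc 1 n, ∑ y ∈ Finset.Icc x n,
      (if y ≤ r then cH i x y * cH j x y else 0) =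
      ∑ y ∈ Finset.Icc 1 r, ∑ x ∈ Finset.Icc 1 y, cH i x y * cH j x y := by
    simp only [← Finset.sum_filter]
    refine Finset.sum_comm' fun x y => ?_
    simp only [Finset.mem_Icc, Finset.mem_filter]
    omega
  conv_lhs => rw [HL.eq_def n r e lam j, lie_add, hb]
  simp only [lie_sum]
  rw [Finset.sum_congr rfl fun x hx => Finset.sum_congr rfl (hN x hx)]
  simp only [← Finset.sum_smul, ← Finset.sum_mul]
  rw [hs, sum_cH r i j hi hj, Bentry]
  split_ifs <;> first | omega | module

end Level

section CrossBracket

variable {n r : ℕ} {γ : ℂ} {e : ℕ → ℕ → ℂ} {lam : ℕ → ℂ}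

theorem lie_lie_lie_expand {R : Type*} [Ring R] (A B X Y : R) :
    ⁅⁅⁅A, B⁆, X⁆, Y⁆ =
      ⁅A, ⁅⁅B, X⁆, Y⁆⁆ + ⁅⁅A, Y⁆, ⁅B, X⁆⁆ + ⁅⁅A, X⁆, ⁅B, Y⁆⁆ - ⁅B, ⁅⁅A, X⁆, Y⁆⁆ := by
  simp only [Ring.lie_def]
  noncomm_ring

theorem lie_lie_E_F_sX {i k : ℕ} (hi : 1 ≤ i) (hin : i ≤ n) (hk : 1 ≤ k) (hkn : k ≤ n)
    (m u : ℤ) (x y : ℕ) (v : ℤ) :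
    ⁅⁅EL n r γ e lam i m, FL n r k u⁆, sX n r x y v⁆ =
      if i = k then cH i x y • sX n r x y (m + u + v) else 0 := by
  rcases lt_trichotomy x (y + 1) with hxy | rfl | hxy
  · have h1 : ⁅EL n r γ e lam i m, if x = k then sX n r (k + 1) y (u + v) else 0⁆ =
        if x = k then cJ i y • PL n r i i (k + 1) y (m + (u + v))
          + (if i = k then sX n r i y (m + (u + v)) else 0)
          - if y + 1 = i then sX n r (k + 1) i (m + (u + v)) else 0 else 0 := by
      by_cases hx : x = k
      · rw [if_pos hx, if_pos hx, lie_E_sX hi hin (show k + 1 ≤ y + 1 by omega)]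
        simp only [Nat.add_right_cancel_iff, eq_comm]
      · rw [if_neg hx, if_neg hx, lie_zero]
    rw [lie_lie, lie_E_sX hi hin hxy.le, lie_F_sX hk hkn, h1]
    simp only [lie_sub, lie_add, bracket_smul, bracket_ite_zero, lie_F_P hk hkn, lie_F_sX hk hkn]
    rw [show m + (u + v) = m + u + v by ring, show u + (m + v) = m + u + v by ring]
    by_cases hik : i = k
    · subst hik
      rw [PL_succ_left, if_pos rfl, if_pos rfl, if_pos rfl, if_pos rfl, cH, cJ]
      clear h1
      split_ifs <;> subst_vars <;> first | omega | module
    · simp only [hik, if_false]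
      split_ifs <;> subst_vars <;> first | omega | module
  · have : cH i (y + 1) y = 0 := by simp [cH]
    rw [this, zero_smul, ite_self, sX_succ]
    split_ifs <;> simp [bracket_one]
  · have h (w : ℤ) : sX n r x y w = 0 := by
      rw [sX, if_neg hxy.ne', sL_of_not_root]
      unfold Root
      omega
    simp [h]

theorem lie_lie_E_F_h {i k : ℕ} (hk : 1 ≤ k) (hkn : k ≤ n) (m u : ℤ) (l : Fin n) (v : ℤ) :
    ⁅⁅EL n r γ e lam i m, FL n r k u⁆, hL n l v⁆ =
      if i = k then (if m + u + v = 0 then (((m + u : ℤ) : ℂ) * e i (l.1 + 1)) • 1 else 0)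
        else 0 := by
  rw [lie_lie, lie_F_h, lie_zero, zero_sub, lie_E_h, bracket_smul, lie_F_sX hk hkn]
  split_ifs with h1 h2
  · subst h1
    rw [sX_succ, if_pos (by omega), show v = -(m + u) by omega]
    push_cast
    module
  · subst h1
    rw [sX_succ, if_neg (by omega), smul_zero, neg_zero]
  · simp

theorem lie_lie_E_F_a_a {i k : ℕ} (hi : 1 ≤ i) (hin : i ≤ n) (hk : 1 ≤ k) {x y p q : ℕ}
    (hxy : Root n x y) (hpq : Root n p q) (m u v w : ℤ) :
    ⁅⁅⁅EL n r γ e lam i m, FL n r k u⁆, aL n r x y v⁆, aL n r p q w⁆ = 0 := by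
  have h2 : ⁅⁅FL n r k u, aL n r x y v⁆, aL n r p q w⁆ = 0 := by
    rw [lie_F_a hk]
    split_ifs <;> simp [lie_a_a]
  have key {x y p q : ℕ} (hxy : Root n x y) (hpq : Root n p q) (v w : ℤ) :
      (if x = k + 1 ∧ x ≤ y then
        -⁅⁅EL n r γ e lam i m, aL n r p q w⁆, aL n r k y (u + v)⁆ else 0) =
      if x = k + 1 then (if p = i ∧ q = i then -(cJ i y • aL n r k y (m + u + v + w)) else 0)
        else 0 := by
    have h := hxy.2.1
    by_cases hx : x = k + 1
    · rw [if_pos hx, if_pos ⟨hx, h⟩, lie_E_a_a hi hin hpq ⟨hk, by omega, hxy.2.2⟩,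
        if_neg (show ¬(k = i ∧ y = i) by omega), add_zero,
        show m + w + (u + v) = m + u + v + w by ring]
      split_ifs <;> simp
    · rw [if_neg hx, if_neg fun h => hx h.1]
  rw [lie_lie_lie_expand, h2, lie_zero, zero_add, lie_E_a_a hi hin hxy hpq, lie_F_a hk, lie_F_a hk,
    bracket_ite_zero, bracket_ite_zero, lie_neg, lie_neg, lie_add, bracket_ite_zero,
    bracket_ite_zero, bracket_smul, bracket_smul, lie_F_a hk, lie_F_a hk, key hxy hpq, key hpq hxy,
    show u + (m + v + w) = m + u + v + w by ring, show m + u + w + v = m + u + v + w by ring]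
  have := hxy.2.1
  have := hpq.2.1
  split_ifs <;> first | omega | module

theorem vev_b (i : ℕ) (m : ℤ) : vev (bL n e lam i m) = if m = 0 then lam i else 0 := by
  have h (k : Fin n) : vev (hL n k m) = 0 := by
    unfold hL
    split_ifs
    · have h := vev_mul_dX (Sum.inr (k, ⟨m.toNat, by omega⟩)) (1 : Module.End ℂ (FSp n))
      rw [one_mul] at h
      rw [vev_smul, h, mul_zero]
    · exact vev_zero
    · simpa using vev_mX_mul (Sum.inr (k, ⟨(-m).toNat, by omega⟩)) (1 : Module.End ℂ (FSp n))
  rw [bL, vev_add, vev_sum]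
  simp only [vev_smul, h, mul_zero, Finset.sum_const_zero, zero_add]
  split_ifs
  · rw [vev_smul, vev_one, mul_one]
  · exact vev_zero

theorem vev_H (i : ℕ) (m : ℤ) : vev (HL n r e lam i m) = if m = 0 then lam i else 0 := by
  rw [HL, vev_add, vev_sum, vev_b]
  simp only [vev_sum, vev_smul, vev_N le_rfl, mul_zero, Finset.sum_const_zero, zero_add]

theorem lie_E_N {i j : ℕ} (hi : 1 ≤ i) (hj : j ∈ Finset.Icc (i + 1) n) (m u : ℤ) :
    ⁅EL n r γ e lam i m, NL n r i j (i + 1) j u⁆ =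
      ⁅NL n r (i + 1) j i j m, NL n r i j (i + 1) j u⁆ := by
  have hj' := Finset.mem_Icc.1 hj
  have hin : i ≤ n := by omega
  have hii : Root n i i := ⟨hi, le_rfl, hin⟩
  have hij : Root n i j := ⟨hi, by omega, hj'.2⟩
  have hij' : Root n (i + 1) j := ⟨by omega, hj'⟩
  have hc : cJ i j = 0 := by
    rw [cJ, if_neg (by omega), if_neg (by omega), sub_zero]
  rw [← sub_eq_zero, ← sub_lie]
  refine lie_N_of_commute le_rfl (fun w => ?_) (fun w => ?_) u
  · have hQ : ⁅QL n r i m, aL n r i j w⁆ = 0 := by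
      rw [QL, lsum_lie (lf_starL_J i m)]
      convert lsum_zero (M := FSp n) using 3 with s
      rw [lie_starL_of_commute, lie_J_a hin hij.2.1, hc]
      · simp [starL_zero]
      · rw [lie_s_a hij, if_neg (by omega)]
    have h1 : ∀ k ∈ Finset.Icc (i + 1) n, ⁅NL n r (i + 1) k i k m, aL n r i j w⁆ =
        if k = j then -aL n r (i + 1) k (m + w) else 0 := fun k _ => by
      rw [lie_N_a le_rfl hij]
      simp
    have h2 : ∀ k ∈ Finset.Ico 1 i, ⁅NL n r k (i - 1) k i m, aL n r i j w⁆ = 0 := fun k hk => by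
      have hk := Finset.mem_Ico.1 hk
      rw [lie_N_a (by omega) hij, if_neg (by omega)]
    rw [EL]
    simp only [sub_lie, add_lie, sum_lie, smul_bracket, hQ, Finset.sum_congr rfl h1,
      Finset.sum_congr rfl h2, Finset.sum_ite_eq', hj, if_true]
    rw [lie_sb_a hii, lie_s_a hij, lie_N_a le_rfl hij, if_neg (by omega), if_neg (by omega),
      if_pos ⟨rfl, rfl⟩]
    simp
  · rw [sub_lie, lie_N_s le_rfl hij', if_pos ⟨rfl, rfl⟩, sL_eq_sX hij'.2.1,
      lie_E_sX hi hin (by omega), hc, if_pos rfl, if_neg (by omega), sL_eq_sX hij.2.1]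
    simp

theorem vev_lie_E_a {i : ℕ} (hi : 1 ≤ i) (hin : i ≤ n) (m u : ℤ) :
    vev ⁅EL n r γ e lam i m, aL n r i i u⁆ =
      if m + u = 0 then lam i - kap r γ i * m else 0 := by
  have hii : Root n i i := ⟨hi, le_rfl, hin⟩
  have hQ : vev ⁅QL n r i m, aL n r i i u⁆ = 0 := by
    rw [QL, lsum_lie (lf_starL_J i m)]
    refine vev_lsum ((lf_starL_J i m).lie' _) fun s => ?_
    have h : ⁅sL n r i i s, aL n r i i u⁆ = (if u + s = 0 then (-1 : ℂ) else 0) • 1 := by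
      rw [lie_s_a hii]
      split_ifs <;> first | omega | module
    rw [lie_starL h, lie_J_a hin le_rfl, starL_smul, vev_add, vev_smul, vev_smul, vev_starL_a,
      vev_J, mul_zero, mul_zero, add_zero]
  have h1 : ∀ k ∈ Finset.Icc (i + 1) n, ⁅NL n r (i + 1) k i k m, aL n r i i u⁆ = 0 := fun k hk => by
    have hk := Finset.mem_Icc.1 hk
    rw [lie_N_a le_rfl hii, if_neg (by omega)]
  have h2 : ∀ k ∈ Finset.Ico 1 i, ⁅NL n r k (i - 1) k i m, aL n r i i u⁆ = 0 := fun k hk => by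
    have hk := Finset.mem_Ico.1 hk
    rw [lie_N_a (by omega) hii, if_neg (by omega)]
  rw [EL]
  simp only [sub_lie, add_lie, sum_lie, smul_bracket, Finset.sum_congr rfl h1,
    Finset.sum_congr rfl h2, Finset.sum_const_zero, vev_sub, vev_add, vev_smul, hQ, vev_zero]
  rw [lie_sb_a hii, lie_s_a hii, if_pos ⟨rfl, rfl⟩, vev_neg, vev_b]
  split_ifs
  · rw [vev_neg, vev_one]
    ring
  · omega
  · omega
  · rw [vev_zero]
    ring

theorem vev_lie_E_F {i : ℕ} (hr : r ≤ n) (hi : 1 ≤ i) (hin : i ≤ n) (m u : ℤ) :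
    vev ⁅EL n r γ e lam i m, FL n r i u⁆ =
      if m + u = 0 then lam i + (γ ^ 2 - (r + 1)) * m else 0 := by
  have h1 : ∀ j ∈ Finset.Icc (i + 1) n, vev ⁅EL n r γ e lam i m, NL n r i j (i + 1) j u⁆ =
      if j ≤ r then (if m + u = 0 then -(m : ℂ) else 0) else 0 := fun j hj => by
    have hj' := Finset.mem_Icc.1 hj
    rw [lie_E_N hi hj, lie_N_N ⟨by omega, hj'⟩ ⟨hi, by omega, hj'.2⟩, vev_sub, vev_sub,
      vev_N le_rfl, vev_N le_rfl, sub_zero, zero_sub]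
    split_ifs <;> first | omega | simp [vev_smul, vev_one, vev_zero]
  have h2 : (Finset.Icc (i + 1) n).filter (· ≤ r) = Finset.Icc (i + 1) r := by
    ext j
    simp only [Finset.mem_filter, Finset.mem_Icc]
    omega
  rw [FL, lie_add, vev_add, vev_lie_E_a hi hin, lie_sum, vev_sum, Finset.sum_congr rfl h1,
    ← Finset.sum_filter, h2, Finset.sum_const, Nat.card_Icc, nsmul_eq_mul, kap]
  split_ifs with h3 h4
  · rw [show r + 1 - (i + 1) = 0 by omega]
    push_cast
    ring
  · rw [Nat.add_sub_add_right, Nat.cast_sub (by omega)]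
    ring
  · ring

end CrossBracket

section Relations

variable {n r : ℕ} {γ : ℂ} {e : ℕ → ℕ → ℂ} {lam : ℕ → ℂ}

theorem bracket_ite_smul_one (A : Module.End ℂ (FSp n)) (P : Prop) [Decidable P] (c : ℂ) :
    ⁅A, if P then c • (1 : Module.End ℂ (FSp n)) else 0⁆ = 0 := by
  rw [bracket_ite_zero, bracket_smul, bracket_one, smul_zero, ite_self]

theorem bracket_a_sX (T : Module.End ℂ (FSp n)) (x y p q : ℕ) (m u : ℤ) :
    ⁅T, ⁅aL n r x y m, sX n r p q u⁆⁆ = 0 := by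
  by_cases hxy : Root n x y
  · by_cases hpq : p = q + 1
    · rw [hpq, sX_succ, bracket_ite_zero, bracket_one, ite_self, lie_zero]
    · rw [sX, if_neg hpq, lie_a_s hxy, bracket_ite_zero, bracket_one, ite_self]
  · rw [aL_of_not_root hxy, zero_lie, lie_zero]

/-- The cross bracket minus the Cartan current; it turns out to be central. -/
theorem lie_E_F_sub_H_eq_smul_one {i k : ℕ} (hi : 1 ≤ i) (hin : i ≤ n) (hk : 1 ≤ k) (hkn : k ≤ n) (m u : ℤ)
    {T : Module.End ℂ (FSp n)}
    (hT : T = ⁅EL n r γ e lam i m, FL n r k u⁆ -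
      if i = k then HL n r e lam i (m + u) else 0) : T = vev T • 1 := by
  have hs (x y : ℕ) (v : ℤ) : ⁅T, sX n r x y v⁆ = 0 := by
    rw [hT, sub_lie, lie_lie_E_F_sX hi hin hk hkn, ite_zero_bracket, lie_H_sX, sub_self]
  have hh (l : Fin n) (v : ℤ) : ⁅T, hL n l v⁆ = 0 := by
    rw [hT, sub_lie, lie_lie_E_F_h hk hkn, ite_zero_bracket, lie_H_h, sub_self]
  have hw : ⁅euler (wt n r fun p => (p : ℂ)), T⁆ = (0 : ℂ) • T := by
    rw [hT, lie_sub, lie_euler_lie (lie_euler_E _ hi m) (lie_euler_F _ k u), bracket_ite_zero,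
      lie_euler_H, ite_self, zero_smul, sub_zero]
    push_cast
    module
  refine eq_smul_one (r := r) (fun x y v hxy => ?_)
    (fun x y v h => by rw [sL_eq_sX h.2.1]; exact hs x y v) hh
  refine eq_zero_of_commute (r := r) (fun p => (p : ℂ)) (fun p q w => ?_) (fun p q w => ?_)
    (fun l w => ?_) (lie_euler_lie hw (lie_euler_a _ x y v)) ?_
  · by_cases hpq : Root n p q
    · rw [hT, sub_lie, sub_lie, lie_lie_E_F_a_a hi hin hk hxy hpq, ite_zero_bracket, lie_H_a,
        ite_zero_bracket, smul_bracket, lie_a_a, smul_zero, ite_self, sub_self]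
    · rw [aL_of_not_root hpq, lie_zero]
  · rw [lie_lie, hs, lie_zero, sub_zero, bracket_a_sX]
  · rw [lie_lie, hh, lie_zero, sub_zero, lie_a_h, lie_zero]
  · have := hxy.2.1
    rw [zero_add, neg_ne_zero, sub_ne_zero]
    exact_mod_cast (show y + 1 ≠ x by omega)

theorem lie_E_F (hr : r ≤ n) {i k : ℕ} (hi : 1 ≤ i) (hin : i ≤ n) (hk : 1 ≤ k) (hkn : k ≤ n)
    (m u : ℤ) :
    ⁅EL n r γ e lam i m, FL n r k u⁆ =
      if i = k then HL n r e lam i (m + u) +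
        (if m + u = 0 then ((γ ^ 2 - (r + 1)) * m) • 1 else 0) else 0 := by
  have h := lie_E_F_sub_H_eq_smul_one (n := n) (r := r) (γ := γ) (e := e) (lam := lam)
    hi hin hk hkn m u rfl
  by_cases hik : i = k
  · subst hik
    rw [if_pos rfl] at h ⊢
    rw [sub_eq_iff_eq_add'.1 h, vev_sub, vev_lie_E_F hr hi hin, vev_H]
    congr 1
    split_ifs <;> module
  · rw [if_neg hik, sub_zero] at h
    rw [if_neg hik]
    have hw := lie_euler_lie (lie_euler_E (n := n) (r := r) (γ := γ) (e := e) (lam := lam)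
      (fun p => if p ≤ i then 0 else 1) hi m)
      (lie_euler_F (fun p => if p ≤ i then 0 else 1) k u)
    refine eq_zero_of_weight h hw ?_
    split_ifs <;> first | omega | norm_num

/-- The commutant of all the modes `a*_{xy,m}` and `h_{k,m}`. -/
def InComm {n : ℕ} (r : ℕ) (T : Module.End ℂ (FSp n)) : Prop :=
  (∀ x y m, ⁅T, sX n r x y m⁆ = 0) ∧ ∀ k m, ⁅T, hL n k m⁆ = 0

theorem InComm.sub {A B : Module.End ℂ (FSp n)} (hA : InComm r A) (hB : InComm r B) :
    InComm r (A - B) :=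
  ⟨fun x y m => by rw [sub_lie, hA.1, hB.1, sub_zero],
    fun k m => by rw [sub_lie, hA.2, hB.2, sub_zero]⟩

theorem InComm.smul {A : Module.End ℂ (FSp n)} (hA : InComm r A) (c : ℂ) : InComm r (c • A) :=
  ⟨fun x y m => by rw [smul_bracket, hA.1, smul_zero],
    fun k m => by rw [smul_bracket, hA.2, smul_zero]⟩

theorem inComm_sX (x y : ℕ) (m : ℤ) : InComm r (sX n r x y m) :=
  ⟨fun _ _ _ => lie_sX_sX .., fun _ _ => lie_sX_h ..⟩

/-- An element of the commutant that commutes with all lowering operators is central, hence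
vanishes if it has nonzero weight. -/
theorem InComm.eq_zero {T : Module.End ℂ (FSp n)} (hT : InComm r T)
    (hF : ∀ k u, 1 ≤ k → k ≤ n → ⁅T, FL n r k u⁆ = 0) (H : ℕ → ℂ) {w : ℂ}
    (hw : ⁅euler (wt n r H), T⁆ = w • T) (h0 : w ≠ 0) : T = 0 := by
  have ha (d : ℕ) : ∀ x y u, n ≤ y + d → Root n x y → ⁅T, aL n r x y u⁆ = 0 := by
    induction d using Nat.strong_induction_on with
    | _ d ih =>
      have hy (y : ℕ) (u : ℤ) (hd : n ≤ y + d) (hyn : 1 ≤ y ∧ y ≤ n) :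
          ⁅T, aL n r y y u⁆ = 0 := by
        have h := hF y u hyn.1 hyn.2
        rw [FL, lie_add, lie_sum, Finset.sum_eq_zero, add_zero] at h
        · exact h
        · intro j hj
          have hj := Finset.mem_Icc.1 hj
          refine lie_N_of_commute le_rfl (fun v => ?_) (fun v => ?_) u
          · exact ih (n - j) (by omega) y j v (by omega) ⟨by omega, by omega, by omega⟩
          · rw [sL_eq_sX (by omega), hT.1]
      have hx (c : ℕ) : ∀ x y u, y = x + c → n ≤ y + d → Root n x y →
          ⁅T, aL n r x y u⁆ = 0 := by
        induction c with
        | zero =>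
          intro x y u hc hd hxy
          obtain rfl : y = x := hc
          exact hy y u hd ⟨hxy.1, hxy.2.2⟩
        | succ c ihc =>
          intro x y u hc hd hxy
          have h := lie_F_a (n := n) (r := r) hxy.1 (x + 1) y u 0
          rw [if_pos ⟨rfl, by omega⟩, add_zero] at h
          rw [← neg_eq_zero, ← lie_neg, ← h, leibniz_lie, hF x u hxy.1 (hxy.2.1.trans hxy.2.2),
            zero_lie,
            ihc (x + 1) y 0 (by omega) hd ⟨by omega, by omega, hxy.2.2⟩, lie_zero, add_zero]
      intro x y u hd hxy
      exact hx (y - x) x y u (by have := hxy.2.1; omega) hd hxy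
  refine eq_zero_of_commute (r := r) H (fun x y m => ?_) hT.1 hT.2 hw h0
  by_cases hxy : Root n x y
  · exact ha n x y m (by omega) hxy
  · rw [aL_of_not_root hxy, lie_zero]

/-- Operators whose adjoint action preserves the commutant. -/
def PresComm {n : ℕ} (r : ℕ) (T : Module.End ℂ (FSp n)) : Prop :=
  (∀ S : Module.End ℂ (FSp n), InComm r S → InComm r ⁅T, S⁆) ∧ ∀ k m, InComm r ⁅T, hL n k m⁆

theorem PresComm.sub {A B : Module.End ℂ (FSp n)} (hA : PresComm r A) (hB : PresComm r B) :
    PresComm r (A - B) :=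
  ⟨fun S hS => by rw [sub_lie]; exact (hA.1 S hS).sub (hB.1 S hS),
    fun k m => by rw [sub_lie]; exact (hA.2 k m).sub (hB.2 k m)⟩

theorem PresComm.smul {A : Module.End ℂ (FSp n)} (hA : PresComm r A) (c : ℂ) :
    PresComm r (c • A) :=
  ⟨fun S hS => by rw [smul_bracket]; exact (hA.1 S hS).smul c,
    fun k m => by rw [smul_bracket]; exact (hA.2 k m).smul c⟩

theorem PresComm.lie {A B : Module.End ℂ (FSp n)} (hA : PresComm r A) (hB : PresComm r B) :
    PresComm r ⁅A, B⁆ :=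
  ⟨fun S hS => by
      rw [lie_lie]
      exact (hA.1 _ (hB.1 S hS)).sub (hB.1 _ (hA.1 S hS)),
    fun k m => by
      rw [lie_lie]
      exact (hA.1 _ (hB.2 k m)).sub (hB.1 _ (hA.2 k m))⟩

theorem presComm_E {i : ℕ} (hi : 1 ≤ i) (hin : i ≤ n) (m : ℤ) :
    PresComm r (EL n r γ e lam i m) := by
  refine ⟨fun S hS => ⟨fun x y u => ?_, fun k u => ?_⟩, fun k u => ?_⟩
  · rw [lie_lie, hS.1, lie_zero, zero_sub, neg_eq_zero]
    by_cases hxy : x ≤ y + 1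
    · have hP : ⁅S, PL n r i i x y (m + u)⁆ = 0 := by
        rw [PL, lie_lsum (lf_P _ _ _ _ _)]
        simp only [lie_mul, hS.1, mul_zero, zero_mul, add_zero, lsum_zero]
      rw [lie_E_sX hi hin hxy, lie_sub, lie_add, bracket_smul, hP, bracket_ite_zero,
        bracket_ite_zero, hS.1, hS.1]
      simp
    · rw [sX, if_neg (by omega), sL_of_not_root (by unfold Root; omega), lie_zero, lie_zero]
  · rw [lie_lie, hS.2, lie_zero, zero_sub, lie_E_h, bracket_smul, hS.1, smul_zero, neg_zero]
  · rw [lie_E_h]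
    exact (inComm_sX i i _).smul _

theorem presComm_H (i : ℕ) (m : ℤ) : PresComm r (HL n r e lam i m) := by
  refine ⟨fun S hS => ⟨fun x y u => ?_, fun k u => ?_⟩, fun k u => ⟨fun x y v => ?_,
    fun l v => ?_⟩⟩
  · rw [lie_lie, hS.1, lie_zero, zero_sub, lie_H_sX, bracket_smul, hS.1, smul_zero, neg_zero]
  · rw [lie_lie, hS.2, lie_zero, zero_sub, lie_H_h, bracket_ite_smul_one, neg_zero]
  · rw [lie_H_h, ← lie_skew, bracket_ite_smul_one, neg_zero]
  · rw [lie_H_h, ← lie_skew, bracket_ite_smul_one, neg_zero]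

/-- A raising operator preserving the commutant and commuting with all lowering operators
vanishes. -/
theorem PresComm.eq_zero {T : Module.End ℂ (FSp n)} (hT : PresComm r T)
    (hF : ∀ k u, 1 ≤ k → k ≤ n → ⁅T, FL n r k u⁆ = 0) {d : ℕ}
    (hw : ⁅euler (wt n r fun p => (p : ℂ)), T⁆ = (d : ℂ) • T) (hd : d ≠ 0) : T = 0 := by
  have hs (c : ℕ) : ∀ x y u, x + c = y + 1 → ⁅T, sX n r x y u⁆ = 0 := by
    induction c with
    | zero =>
      rintro x y u rfl
      rw [sX_succ, bracket_ite_zero, bracket_one, ite_self]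
    | succ c ih =>
      intro x y u hc
      by_cases hxy : Root n x y
      · refine (hT.1 _ (inComm_sX x y u)).eq_zero (fun k v hk hkn => ?_) (fun p => (p : ℂ))
          (lie_euler_lie hw (by rw [← sL_eq_sX hxy.2.1]; exact lie_euler_s _ x y u)) ?_
        · rw [lie_lie, hF k v hk hkn, lie_zero, sub_zero, ← lie_skew (sX n r x y u),
            lie_F_sX hk hkn, lie_neg, bracket_ite_zero]
          split_ifs with hx
          · rw [ih (k + 1) y _ (by omega), neg_zero]
          · exact neg_zero
        · rw [← Nat.cast_sub (by omega), ← Nat.cast_add]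
          exact_mod_cast (show d + (y + 1 - x) ≠ 0 by omega)
      · rw [sX, if_neg (by omega), sL_of_not_root hxy, lie_zero]
  refine InComm.eq_zero ⟨fun x y u => ?_, fun k u => ?_⟩ hF _ hw (Nat.cast_ne_zero.2 hd)
  · by_cases hxy : x ≤ y + 1
    · exact hs (y + 1 - x) x y u (by omega)
    · rw [sX, if_neg (by omega), sL_of_not_root (by unfold Root; omega), lie_zero]
  · refine (hT.2 k u).eq_zero (fun l v hl hln => ?_) (fun p => (p : ℂ))
      (lie_euler_lie hw ((lie_euler_h _ k u).trans (zero_smul ℂ _).symm))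
      (by simpa using hd)
    rw [lie_lie, ← lie_skew (hL n k u), lie_F_h, neg_zero, lie_zero, hF l v hl hln, lie_zero,
      sub_zero]

end Relations

section Serre

variable {n r : ℕ} {γ : ℂ} {e : ℕ → ℕ → ℂ} {lam : ℕ → ℂ}

theorem cH_self (i j : ℕ) : cH i j j = cartanEntry i j := by
  unfold cH cartanEntry
  split_ifs <;> first | omega | norm_num

theorem lie_H_E (hr : r ≤ n)
    (he : ∀ i j, 1 ≤ i → i ≤ n → 1 ≤ j → j ≤ n →
      (∑ k : Fin n, e i (k.1 + 1) * e j (k.1 + 1)) = Bentry r γ i j)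
    {i j : ℕ} (hi : 1 ≤ i) (hin : i ≤ n) (hj : 1 ≤ j) (hjn : j ≤ n) (m p : ℤ) :
    ⁅HL n r e lam i m, EL n r γ e lam j p⁆ = cartanEntry i j • EL n r γ e lam j (m + p) := by
  rw [← sub_eq_zero]
  refine PresComm.eq_zero (d := 1) (((presComm_H i m).lie (presComm_E hj hjn p)).sub
    ((presComm_E hj hjn (m + p)).smul (cartanEntry i j))) (fun k u hk hkn => ?_) ?_ one_ne_zero
  · rw [sub_lie, smul_bracket, lie_lie, lie_E_F hr hj hjn hk hkn, lie_E_F hr hj hjn hk hkn,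
      lie_H_F hk hkn, bracket_smul, lie_E_F hr hj hjn hk hkn, bracket_ite_zero, lie_add,
      bracket_ite_smul_one, lie_H_H γ hr he hi hin hj hjn, cH_self i k]
    by_cases hjk : j = k
    · subst hjk
      simp only [if_true, show p + (m + u) = m + p + u by ring,
        show m + (p + u) = m + p + u by ring]
      split_ifs
      · push_cast
        module
      · module
    · simp [hjk]
  · rw [lie_sub, lie_euler_lie ((lie_euler_H _ i m).trans (zero_smul ℂ _).symm)
      (lie_euler_E _ hj p), bracket_smul, lie_euler_E _ hj]
    push_cast
    module

theorem lie_lie_E_E_F (hr : r ≤ n)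
    (he : ∀ i j, 1 ≤ i → i ≤ n → 1 ≤ j → j ≤ n →
      (∑ k : Fin n, e i (k.1 + 1) * e j (k.1 + 1)) = Bentry r γ i j)
    {i j k : ℕ} (hi : 1 ≤ i) (hin : i ≤ n) (hj : 1 ≤ j) (hjn : j ≤ n) (hk : 1 ≤ k) (hkn : k ≤ n)
    (m p u : ℤ) :
    ⁅⁅EL n r γ e lam i m, EL n r γ e lam j p⁆, FL n r k u⁆ =
      (if i = k then cartanEntry i j • EL n r γ e lam j (m + p + u) else 0)
        - if j = k then cartanEntry j i • EL n r γ e lam i (m + p + u) else 0 := by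
  rw [lie_lie, lie_E_F hr hj hjn hk hkn, lie_E_F hr hi hin hk hkn, bracket_ite_zero,
    bracket_ite_zero, lie_add, lie_add, bracket_ite_smul_one, bracket_ite_smul_one, add_zero,
    add_zero, ← lie_skew, lie_H_E hr he hj hjn hi hin,
    ← lie_skew (EL n r γ e lam j p), lie_H_E hr he hi hin hj hjn,
    show p + u + m = m + p + u by ring, show m + u + p = m + p + u by ring]
  split_ifs <;> module

theorem lie_euler_E_E (i j : ℕ) (hi : 1 ≤ i) (hj : 1 ≤ j) (m p : ℤ) :
    ⁅euler (wt n r fun q => (q : ℂ)), ⁅EL n r γ e lam i m, EL n r γ e lam j p⁆⁆ =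
      ((2 : ℕ) : ℂ) • ⁅EL n r γ e lam i m, EL n r γ e lam j p⁆ := by
  rw [lie_euler_lie (lie_euler_E _ hi m) (lie_euler_E _ hj p)]
  push_cast
  module

theorem lie_E_E (hr : r ≤ n)
    (he : ∀ i j, 1 ≤ i → i ≤ n → 1 ≤ j → j ≤ n →
      (∑ k : Fin n, e i (k.1 + 1) * e j (k.1 + 1)) = Bentry r γ i j)
    {i j : ℕ} (hi : 1 ≤ i) (hin : i ≤ n) (hj : 1 ≤ j) (hjn : j ≤ n)
    (hij : ¬(i + 1 = j ∨ j + 1 = i)) (m p : ℤ) :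
    ⁅EL n r γ e lam i m, EL n r γ e lam j p⁆ = 0 := by
  refine ((presComm_E hi hin m).lie (presComm_E hj hjn p)).eq_zero (fun k u hk hkn => ?_)
    (lie_euler_E_E i j hi hj m p) two_ne_zero
  rw [lie_lie_E_E_F hr he hi hin hj hjn hk hkn]
  by_cases h : i = j
  · subst h
    exact sub_self _
  · have h1 : cartanEntry i j = 0 := by rw [cartanEntry, if_neg h, if_neg hij]
    have h2 : cartanEntry j i = 0 := by
      rw [cartanEntry, if_neg (Ne.symm h), if_neg fun h => hij h.symm]
    rw [h1, h2]
    simp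

theorem lie_E_E_congr (hr : r ≤ n)
    (he : ∀ i j, 1 ≤ i → i ≤ n → 1 ≤ j → j ≤ n →
      (∑ k : Fin n, e i (k.1 + 1) * e j (k.1 + 1)) = Bentry r γ i j)
    {i j : ℕ} (hi : 1 ≤ i) (hin : i ≤ n) (hj : 1 ≤ j) (hjn : j ≤ n) {m p m' p' : ℤ}
    (h : m + p = m' + p') :
    ⁅EL n r γ e lam i m, EL n r γ e lam j p⁆ = ⁅EL n r γ e lam i m', EL n r γ e lam j p'⁆ := by
  rw [← sub_eq_zero]
  refine (((presComm_E hi hin m).lie (presComm_E hj hjn p)).sub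
    ((presComm_E hi hin m').lie (presComm_E hj hjn p'))).eq_zero (fun k u hk hkn => ?_)
    ?_ two_ne_zero
  · rw [sub_lie, lie_lie_E_E_F hr he hi hin hj hjn hk hkn,
      lie_lie_E_E_F hr he hi hin hj hjn hk hkn, h, sub_self]
  · rw [lie_sub, lie_euler_E_E i j hi hj, lie_euler_E_E i j hi hj, smul_sub]

theorem lie_E_E_E (hr : r ≤ n)
    (he : ∀ i j, 1 ≤ i → i ≤ n → 1 ≤ j → j ≤ n →
      (∑ k : Fin n, e i (k.1 + 1) * e j (k.1 + 1)) = Bentry r γ i j)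
    {i j : ℕ} (hi : 1 ≤ i) (hin : i ≤ n) (hj : 1 ≤ j) (hjn : j ≤ n)
    (hij : i + 1 = j ∨ j + 1 = i) (m u p : ℤ) :
    ⁅EL n r γ e lam i m, ⁅EL n r γ e lam i u, EL n r γ e lam j p⁆⁆ = 0 := by
  have hii : cartanEntry i i = 2 := if_pos rfl
  have hij' : cartanEntry i j = -1 := by rw [cartanEntry, if_neg (by omega), if_pos hij]
  refine ((presComm_E hi hin m).lie ((presComm_E hi hin u).lie (presComm_E hj hjn p))).eq_zero
    (d := 3) (fun k v hk hkn => ?_) ?_ three_ne_zero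
  · rw [lie_lie, lie_lie_E_E_F hr he hi hin hj hjn hk hkn, lie_E_F hr hi hin hk hkn, lie_sub,
      bracket_ite_zero, bracket_ite_zero, bracket_ite_zero, bracket_smul, bracket_smul, lie_add,
      bracket_ite_smul_one, add_zero, lie_E_E hr he hi hin hi hin (by omega), smul_zero, ite_self,
      sub_zero, ← lie_skew _ (HL n r e lam i (m + v)), leibniz_lie,
      lie_H_E hr he hi hin hi hin, lie_H_E hr he hi hin hj hjn, smul_bracket, bracket_smul, hii,
      hij',
      lie_E_E_congr hr he hi hin hj hjn (show m + v + u + p = m + (u + p + v) by ring),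
      lie_E_E_congr hr he hi hin hj hjn (show u + (m + v + p) = m + (u + p + v) by ring)]
    split_ifs <;> module
  · rw [lie_euler_lie (lie_euler_E _ hi m) (lie_euler_E_E i j hi hj u p)]
    push_cast
    module

theorem opComm_coe (A B : Module.End ℂ (FSp n)) : opComm n ⇑A ⇑B = ⇑⁅A, B⁆ := rfl

end Serre

end Wakimoto

/-- Serre relations (R5) and (R6): if `(α_i|α_j) ≠ −1` (i.e. `|i−j| ≠ 1`)
then `[ρ(E_i)_m, ρ(E_j)_p] = [ρ(F_i)_m, ρ(F_j)_p] = 0`; if `(α_i|α_j) = −1`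
(i.e. `|i−j| = 1`) then `[ρ(E_i)_{m₁},[ρ(E_i)_{m₂}, ρ(E_j)_p]] = 0` and
`[ρ(F_i)_{m₁},[ρ(F_i)_{m₂}, ρ(F_j)_p]] = 0`. -/
theorem wakimoto_serre (n r : ℕ) (γ : ℂ) (e : ℕ → ℕ → ℂ) (lam : ℕ → ℂ)
    (hn : 1 ≤ n) (hr : r ≤ n)
    (he : ∀ i j, 1 ≤ i → i ≤ n → 1 ≤ j → j ≤ n →
      (∑ k : Fin n, e i (k.1 + 1) * e j (k.1 + 1)) = Bentry r γ i j)
    (i j : ℕ) (hi : 1 ≤ i) (hi' : i ≤ n) (hj : 1 ≤ j) (hj' : j ≤ n) :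
    (∀ m p : ℤ, ¬(i + 1 = j ∨ j + 1 = i) →
      opComm n (rhoE n r γ e lam i m) (rhoE n r γ e lam j p) = 0 ∧
      opComm n (rhoF n r i m) (rhoF n r j p) = 0) ∧
    (∀ m₁ m₂ p : ℤ, (i + 1 = j ∨ j + 1 = i) →
      opComm n (rhoE n r γ e lam i m₁)
        (opComm n (rhoE n r γ e lam i m₂) (rhoE n r γ e lam j p)) = 0 ∧
      opComm n (rhoF n r i m₁)
        (opComm n (rhoF n r i m₂) (rhoF n r j p)) = 0) := by
  refine ⟨fun m p h => ⟨?_, ?_⟩, fun m₁ m₂ p h => ⟨?_, ?_⟩⟩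
  · rw [← Wakimoto.EL_coe, ← Wakimoto.EL_coe, Wakimoto.opComm_coe,
      Wakimoto.lie_E_E hr he hi hi' hj hj' h]
    rfl
  · rw [← Wakimoto.FL_coe, ← Wakimoto.FL_coe, Wakimoto.opComm_coe,
      Wakimoto.lie_F_F hi hi' hj hj' h]
    rfl
  · rw [← Wakimoto.EL_coe, ← Wakimoto.EL_coe, ← Wakimoto.EL_coe, Wakimoto.opComm_coe,
      Wakimoto.opComm_coe, Wakimoto.lie_E_E_E hr he hi hi' hj hj' h]
    rfl
  · rw [← Wakimoto.FL_coe, ← Wakimoto.FL_coe, ← Wakimoto.FL_coe, Wakimoto.opComm_coe,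
      Wakimoto.opComm_coe, Wakimoto.lie_F_F_F hi hi' hj hj' h]
    rfl
end

section
/- For all 1 ≤ j < i ≤ n and all m_j, m_{j+1}, …, m_i ∈ ℤ, setting M = m_j + m_{j+1} + ⋯ + m_i, the iterated commutator of the intermediate Wakimoto lowering operators satisfies [ρ(F_i)_{m_i}, [ρ(F_{i−1})_{m_{i−1}}, [⋯, ρ(F_j)_{m_j}]⋯]] = a_{ji,M} + Σ_{q=i+1}^{n} Σ_{s∈ℤ} a_{jq,s} a*_{i+1,q,M−s}. -/
open MvPolynomial

/-- The iterated (Engel) commutator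
`[ρ(F_{j+d})_{ms (j+d)}, [ρ(F_{j+d−1})_{ms (j+d−1)}, [⋯, ρ(F_j)_{ms j}]⋯]]`. -/
noncomputable def nestedF (n r : ℕ) (ms : ℕ → ℤ) (j : ℕ) : ℕ → (FSp n → FSp n)
  | 0 => rhoF n r j (ms j)
  | d + 1 => opComm n (rhoF n r (j + d + 1) (ms (j + d + 1))) (nestedF n r ms j d)

theorem pderiv_comm_apply {σ R : Type*} [CommRing R] (a b : σ) (w : MvPolynomial σ R) :
    pderiv a (pderiv b w) = pderiv b (pderiv a w) := by
  classical
  have h : ⁅pderiv (R := R) a, pderiv (R := R) b⁆ = 0 := by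
    refine MvPolynomial.derivation_ext fun i => ?_
    rw [Derivation.commutator_apply, pderiv_X, pderiv_X]
    simp only [Pi.single_apply]
    split_ifs <;> simp
  have := DFunLike.congr_fun h w
  rwa [Derivation.commutator_apply, Derivation.zero_apply, sub_eq_zero] at this

theorem finite_setOf_pderiv_ne_zero {σ τ R : Type*} [CommSemiring R] {f : τ → σ}
    (hf : Function.Injective f) (w : MvPolynomial σ R) :
    {s | pderiv (f s) w ≠ 0}.Finite := by
  refine (w.vars.finite_toSet.preimage hf.injOn).subset fun s hs => ?_
  by_contra hmem
  exact hs (pderiv_eq_zero_of_notMem_vars hmem)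

section WakimotoOperators

variable (n r : ℕ)

theorem aop_add (i j : ℕ) (m : ℤ) (w w' : FSp n) :
    aop n r i j m (w + w') = aop n r i j m w + aop n r i j m w' := by
  unfold aop
  split_ifs <;> simp [mul_add]

theorem astarop_add (i j : ℕ) (m : ℤ) (w w' : FSp n) :
    astarop n r i j m (w + w') = astarop n r i j m w + astarop n r i j m w' := by
  unfold astarop
  split_ifs <;> simp only [Pi.zero_apply, mul_add, map_add, neg_add, add_zero]

/-- `aop` as an additive endomorphism. -/
noncomputable def aopHom (i j : ℕ) (m : ℤ) : FSp n →+ FSp n :=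
  AddMonoidHom.mk' (aop n r i j m) (aop_add n r i j m)

/-- `astarop` as an additive endomorphism. -/
noncomputable def astaropHom (i j : ℕ) (m : ℤ) : FSp n →+ FSp n :=
  AddMonoidHom.mk' (astarop n r i j m) (astarop_add n r i j m)

theorem aop_zero (i j : ℕ) (m : ℤ) : aop n r i j m 0 = 0 := map_zero (aopHom n r i j m)

theorem astarop_zero (i j : ℕ) (m : ℤ) : astarop n r i j m 0 = 0 :=
  map_zero (astaropHom n r i j m)

theorem aop_aop_comm (i j k l : ℕ) (m p : ℤ) (w : FSp n) :
    aop n r i j m (aop n r k l p w) = aop n r k l p (aop n r i j m w) := by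
  unfold aop
  split_ifs with h1 h2 h3 h4 h5 h6 h7 <;>
    simp only [Pi.zero_apply, map_zero, mul_zero, Derivation.leibniz, smul_eq_mul]
  · exact pderiv_comm_apply _ _ _
  · rw [pderiv_X_of_ne]
    · ring
    · intro h
      simp only [Sum.inl.injEq, Prod.mk.injEq, Subtype.mk.injEq] at h
      omega
  · rw [pderiv_X_of_ne]
    · ring
    · intro h
      simp only [Sum.inl.injEq, Prod.mk.injEq, Subtype.mk.injEq] at h
      omega
  · ring
  · split_ifs <;> simp

theorem astarop_astarop_comm (i j k l : ℕ) (m p : ℤ) (w : FSp n) :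
    astarop n r i j m (astarop n r k l p w) = astarop n r k l p (astarop n r i j m w) := by
  unfold astarop
  split_ifs with h1 h2 h3 h4 h5 h6 h7 <;>
    simp only [Pi.zero_apply, map_zero, mul_zero, neg_zero, map_neg, neg_neg,
      Derivation.leibniz, smul_eq_mul]
  · ring
  · rw [pderiv_X_of_ne]
    · ring
    · intro h
      simp only [Sum.inl.injEq, Prod.mk.injEq, Subtype.mk.injEq] at h
      omega
  · rw [pderiv_X_of_ne]
    · ring
    · intro h
      simp only [Sum.inl.injEq, Prod.mk.injEq, Subtype.mk.injEq] at h
      omega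
  · exact pderiv_comm_apply _ _ _
  · split_ifs <;> simp

theorem aop_astarop_comm_of_ne {i j k l : ℕ} {m p : ℤ} (hne : ¬(i = k ∧ j = l ∧ m = -p))
    (w : FSp n) :
    aop n r i j m (astarop n r k l p w) = astarop n r k l p (aop n r i j m w) := by
  unfold aop astarop
  split_ifs with h1 h2 h3 h4 h5 h6 h7 <;>
    simp only [Pi.zero_apply, map_zero, mul_zero, map_neg,
      Derivation.leibniz, smul_eq_mul]
  · rw [pderiv_X_of_ne]
    · ring
    · intro h
      simp only [Sum.inl.injEq, Prod.mk.injEq, Subtype.mk.injEq] at h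
      omega
  · rw [pderiv_comm_apply]
  · ring
  · rw [pderiv_X_of_ne]
    · ring
    · intro h
      simp only [Sum.inl.injEq, Prod.mk.injEq, Subtype.mk.injEq] at h
      omega
  · split_ifs <;> simp

theorem aop_astarop_neg {i j : ℕ} (h : 1 ≤ i ∧ i ≤ j ∧ j ≤ n) (m : ℤ) (w : FSp n) :
    aop n r i j m (astarop n r i j (-m) w) = astarop n r i j (-m) (aop n r i j m w) + w := by
  unfold aop astarop
  simp only [h, neg_neg, and_self, dite_true, Left.neg_nonpos_iff]
  split_ifs <;> simp only [Derivation.leibniz, pderiv_X_self, smul_eq_mul] <;> ring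

theorem finite_support_aop_astarop {i k : ℕ} (hik : i ≠ k) (j : ℕ) (m : ℤ) (w : FSp n) :
    (Function.support fun s : ℤ => aop n r i j s (astarop n r k j (m - s) w)).Finite := by
  by_cases h1 : 1 ≤ i ∧ i ≤ j ∧ j ≤ n
  swap
  · simp [aop, h1]
  by_cases h2 : 1 ≤ k ∧ k ≤ j ∧ j ≤ n
  swap
  · simp [astarop, h2, aop_zero]
  have f1 := finite_setOf_pderiv_ne_zero
    (f := fun s : ℤ => (Sum.inl (⟨(i, j), h1⟩, s) : XIdx n ⊕ YIdx n))
    (fun s t h => by simpa using h) w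
  have f2 := finite_setOf_pderiv_ne_zero
    (f := fun s : ℤ => (Sum.inl (⟨(k, j), h2⟩, -(m - s)) : XIdx n ⊕ YIdx n))
    (fun s t h => by simpa using h) w
  refine ((f1.union f2).union (Set.finite_Icc m 0)).subset fun s hs => ?_
  by_contra hc
  simp only [Set.mem_union, Set.mem_ofPred_eq, Set.mem_Icc, not_or, not_not] at hc
  obtain ⟨⟨e1, e2⟩, e3⟩ := hc
  apply hs
  by_cases hann : m - s ≤ 0 ∧ j ≤ r
  · change aop n r i j s (astarop n r k j (m - s) w) = 0
    rw [aop_astarop_comm_of_ne n r (fun h => hik h.1)]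
    have : aop n r i j s w = 0 := by
      simp only [aop, h1, and_self, dite_true]
      rw [if_pos ⟨by omega, hann.2⟩]
      exact e1
    rw [this, astarop_zero]
  · change aop n r i j s (astarop n r k j (m - s) w) = 0
    have : astarop n r k j (m - s) w = 0 := by
      simp only [astarop, h2, and_self, dite_true]
      rw [if_neg hann]
      simpa using e2
    rw [this, aop_zero]

/-- The operator `∑ₛ a_{ij,s} a*_{kj,m-s}` for `i ≠ k`, as an additive endomorphism. -/
noncomputable def pairHom {i k : ℕ} (hik : i ≠ k) (j : ℕ) (m : ℤ) : FSp n →+ FSp n :=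
  AddMonoidHom.mk' (fun w => ∑ᶠ s : ℤ, aop n r i j s (astarop n r k j (m - s) w))
    fun w w' => by
      rw [← finsum_add_distrib (finite_support_aop_astarop n r hik j m w)
        (finite_support_aop_astarop n r hik j m w')]
      simp only [astarop_add, aop_add]

theorem pairHom_apply {i k : ℕ} (hik : i ≠ k) (j : ℕ) (m : ℤ) (w : FSp n) :
    pairHom n r hik j m w = ∑ᶠ s : ℤ, aop n r i j s (astarop n r k j (m - s) w) := rfl

theorem pairHom_aop {i k : ℕ} (hik : i ≠ k) (j : ℕ) (m : ℤ) {u v : ℕ}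
    (hne : ¬(u = k ∧ v = j)) (p : ℤ) (w : FSp n) :
    pairHom n r hik j m (aop n r u v p w) = aop n r u v p (pairHom n r hik j m w) := by
  have h := (aopHom n r u v p).map_finsum (finite_support_aop_astarop n r hik j m w)
  refine Eq.trans (finsum_congr fun s => ?_) h.symm
  change _ = aop n r u v p (aop n r i j s (astarop n r k j (m - s) w))
  rw [aop_aop_comm n r u v, aop_astarop_comm_of_ne n r (fun h => hne ⟨h.1, h.2.1⟩)]

theorem pairHom_astarop_of_ne {i k : ℕ} (hik : i ≠ k) (j : ℕ) (m : ℤ) {u v : ℕ}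
    (hne : ¬(i = u ∧ j = v)) (p : ℤ) (w : FSp n) :
    pairHom n r hik j m (astarop n r u v p w) = astarop n r u v p (pairHom n r hik j m w) := by
  have h := (astaropHom n r u v p).map_finsum (finite_support_aop_astarop n r hik j m w)
  refine Eq.trans (finsum_congr fun s => ?_) h.symm
  change _ = astarop n r u v p (aop n r i j s (astarop n r k j (m - s) w))
  rw [astarop_astarop_comm, aop_astarop_comm_of_ne n r (fun h => hne ⟨h.1, h.2.1⟩)]

theorem pairHom_astarop_self {i k : ℕ} (hik : i ≠ k) {j : ℕ} (hv : 1 ≤ i ∧ i ≤ j ∧ j ≤ n)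
    (m p : ℤ) (w : FSp n) :
    pairHom n r hik j m (astarop n r i j p w) =
      astarop n r i j p (pairHom n r hik j m w) + astarop n r k j (m + p) w := by
  have hfin := finite_support_aop_astarop n r hik j m w
  have h := (astaropHom n r i j p).map_finsum hfin
  have hpt : ∀ s : ℤ, aop n r i j s (astarop n r k j (m - s) (astarop n r i j p w)) =
      astaropHom n r i j p (aop n r i j s (astarop n r k j (m - s) w)) +
        (if s = -p then astarop n r k j (m + p) w else 0) := by
    intro s
    change _ = astarop n r i j p (aop n r i j s (astarop n r k j (m - s) w)) + _
    rw [astarop_astarop_comm]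
    split_ifs with hs
    · obtain rfl : p = -s := by omega
      rw [aop_astarop_neg n r hv, sub_eq_add_neg]
    · rw [aop_astarop_comm_of_ne n r (fun h => hs h.2.2), add_zero]
  rw [pairHom_apply, finsum_congr hpt, finsum_add_distrib, ← h]
  · congr 1
    rw [finsum_eq_single _ (-p) (fun s hs => if_neg hs), if_pos rfl]
  · refine hfin.subset fun s hs h0 => hs ?_
    exact (congrArg (astaropHom n r i j p) h0).trans (map_zero _)
  · refine (Set.finite_singleton (-p)).subset fun s hs => ?_
    by_contra hc
    exact hs (if_neg hc)

/-- `rhoF` as an additive endomorphism. -/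
noncomputable def rhoFHom (i : ℕ) (m : ℤ) : FSp n →+ FSp n :=
  aopHom n r i i m + ∑ j ∈ Finset.Icc (i + 1) n, pairHom n r (Nat.succ_ne_self i).symm j m

theorem rhoFHom_apply (i : ℕ) (m : ℤ) (w : FSp n) :
    rhoFHom n r i m w = aop n r i i m w +
      ∑ j ∈ Finset.Icc (i + 1) n, pairHom n r (Nat.succ_ne_self i).symm j m w := by
  simp only [rhoFHom, AddMonoidHom.add_apply, AddMonoidHom.finsetSum_apply]
  rfl

theorem rhoF_eq_rhoFHom (i : ℕ) (m : ℤ) : rhoF n r i m = rhoFHom n r i m := by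
  funext w
  rw [rhoFHom_apply]
  rfl

theorem rhoFHom_aop {i u v : ℕ} (hu : u ≠ i + 1) (m p : ℤ) (w : FSp n) :
    rhoFHom n r i m (aop n r u v p w) = aop n r u v p (rhoFHom n r i m w) := by
  change _ = aopHom n r u v p (rhoFHom n r i m w)
  simp only [rhoFHom_apply, map_add, map_sum]
  congr 1
  · exact aop_aop_comm ..
  · exact Finset.sum_congr rfl fun j _ => pairHom_aop n r _ j m (fun h => hu h.1) p w

theorem rhoFHom_astarop_self {i : ℕ} (h : 1 ≤ i ∧ i ≤ n) (m p : ℤ) (w : FSp n) :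
    rhoFHom n r i m (astarop n r i i p w) =
      astarop n r i i p (rhoFHom n r i m w) + if p = -m then w else 0 := by
  change _ = astaropHom n r i i p (rhoFHom n r i m w) + _
  simp only [rhoFHom_apply, map_add, map_sum]
  have hsum : ∑ j ∈ Finset.Icc (i + 1) n,
        pairHom n r (Nat.succ_ne_self i).symm j m (astarop n r i i p w) =
      ∑ j ∈ Finset.Icc (i + 1) n,
        astaropHom n r i i p (pairHom n r (Nat.succ_ne_self i).symm j m w) := by
    refine Finset.sum_congr rfl fun j hj => pairHom_astarop_of_ne n r _ j m ?_ p w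
    have := (Finset.mem_Icc.mp hj).1
    omega
  rw [hsum, add_right_comm]
  congr 1
  change _ = astarop n r i i p (aop n r i i m w) + _
  split_ifs with hp
  · rw [hp, aop_astarop_neg n r ⟨h.1, le_rfl, h.2⟩]
  · rw [aop_astarop_comm_of_ne n r (fun h => hp (by omega)), add_zero]

theorem rhoFHom_astarop_of_lt {i q : ℕ} (h : 1 ≤ i) (hiq : i < q) (hq : q ≤ n) (m p : ℤ)
    (w : FSp n) :
    rhoFHom n r i m (astarop n r i q p w) =
      astarop n r i q p (rhoFHom n r i m w) + astarop n r (i + 1) q (m + p) w := by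
  change _ = astaropHom n r i q p (rhoFHom n r i m w) + _
  simp only [rhoFHom_apply, map_add, map_sum]
  rw [aop_astarop_comm_of_ne n r (by omega), add_assoc]
  congr 1
  have hmem : q ∈ Finset.Icc (i + 1) n := Finset.mem_Icc.mpr ⟨hiq, hq⟩
  rw [← Finset.add_sum_erase _ _ hmem, ← Finset.add_sum_erase _ _ hmem,
    pairHom_astarop_self n r _ ⟨h, hiq.le, hq⟩, add_right_comm]
  congr 2
  exact Finset.sum_congr rfl fun j hj =>
    pairHom_astarop_of_ne n r _ j m (fun h => (Finset.mem_erase.mp hj).1 h.2) p w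

theorem rhoFHom_pairHom {i j q : ℕ} (hij : j ≠ i) (hj : j ≠ i + 1) (m M : ℤ) (w : FSp n)
    {g : ℤ → FSp n}
    (hg : ∀ s, rhoFHom n r i m (astarop n r i q (M - s) w) =
      astarop n r i q (M - s) (rhoFHom n r i m w) + g s)
    (hfin : (Function.support fun s => aop n r j q s (g s)).Finite) :
    rhoFHom n r i m (pairHom n r hij q M w) =
      pairHom n r hij q M (rhoFHom n r i m w) + ∑ᶠ s, aop n r j q s (g s) := by
  rw [pairHom_apply, pairHom_apply,
    (rhoFHom n r i m).map_finsum (finite_support_aop_astarop n r hij q M w),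
    ← finsum_add_distrib (finite_support_aop_astarop n r hij q M _) hfin]
  refine finsum_congr fun s => ?_
  rw [rhoFHom_aop n r hj, hg, aop_add]

theorem rhoFHom_pairHom_self {i j : ℕ} (h : 1 ≤ i ∧ i ≤ n) (hij : j ≠ i) (hj : j ≠ i + 1)
    (m M : ℤ) (w : FSp n) :
    rhoFHom n r i m (pairHom n r hij i M w) =
      pairHom n r hij i M (rhoFHom n r i m w) + aop n r j i (M + m) w := by
  have hz : ∀ s, s ≠ M + m → aop n r j i s (if M - s = -m then w else 0) = 0 := by
    intro s hs
    rw [if_neg (by omega), aop_zero]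
  rw [rhoFHom_pairHom n r hij hj m M w (fun s => rhoFHom_astarop_self n r h m (M - s) w),
    finsum_eq_single _ (M + m) hz, if_pos (by ring)]
  refine (Set.finite_singleton (M + m)).subset fun s hs => ?_
  by_contra hc
  exact hs (hz s hc)

theorem rhoFHom_pairHom_of_lt {i j q : ℕ} (h : 1 ≤ i) (hiq : i < q) (hq : q ≤ n)
    (hij : j ≠ i) (hj : j ≠ i + 1) (m M : ℤ) (w : FSp n) :
    rhoFHom n r i m (pairHom n r hij q M w) =
      pairHom n r hij q M (rhoFHom n r i m w) + pairHom n r hj q (M + m) w := by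
  have hg : ∀ s, rhoFHom n r i m (astarop n r i q (M - s) w) =
      astarop n r i q (M - s) (rhoFHom n r i m w) + astarop n r (i + 1) q (M + m - s) w := by
    intro s
    rw [rhoFHom_astarop_of_lt n r h hiq hq, show m + (M - s) = M + m - s by ring]
  exact rhoFHom_pairHom n r hij hj m M w hg (finite_support_aop_astarop n r hj q (M + m) w)

theorem nestedF_apply {j d : ℕ} (hj : 1 ≤ j) (hd : j + d ≤ n) (ms : ℕ → ℤ) (w : FSp n) :
    nestedF n r ms j d w = aop n r j (j + d) (∑ t ∈ Finset.Icc j (j + d), ms t) w +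
      ∑ q ∈ Finset.Icc (j + d + 1) n,
        pairHom n r (show j ≠ j + d + 1 by omega) q (∑ t ∈ Finset.Icc j (j + d), ms t) w := by
  induction d generalizing w with
  | zero =>
    simp only [nestedF, add_zero, Finset.Icc_self, Finset.sum_singleton]
    rfl
  | succ d ih =>
    have hd' : j + d + 1 ≤ n := hd
    have hM : ∑ t ∈ Finset.Icc j (j + (d + 1)), ms t =
        ∑ t ∈ Finset.Icc j (j + d), ms t + ms (j + d + 1) :=
      Finset.sum_Icc_succ_top (show j ≤ j + d + 1 by omega) ms
    rw [hM]
    simp only [nestedF, opComm, rhoF_eq_rhoFHom]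
    rw [ih (by omega), ih (by omega)]
    simp only [map_add, map_sum]
    have hj1 : j ≠ j + d + 1 := by omega
    have hj2 : j ≠ j + d + 1 + 1 := by omega
    rw [rhoFHom_aop n r hj2, ← Finset.add_sum_Ioc_eq_sum_Icc hd',
      ← Finset.add_sum_Ioc_eq_sum_Icc hd',
      rhoFHom_pairHom_self n r ⟨by omega, hd'⟩ hj1 hj2]
    have hIoc : Finset.Ioc (j + d + 1) n = Finset.Icc (j + (d + 1) + 1) n := by
      ext
      simp only [Finset.mem_Ioc, Finset.mem_Icc]
      omega
    have hsum := Finset.sum_congr (rfl : Finset.Ioc (j + d + 1) n = _) fun q hq =>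
      rhoFHom_pairHom_of_lt n r (by omega) (Finset.mem_Ioc.mp hq).1 (Finset.mem_Ioc.mp hq).2
        hj1 hj2 (ms (j + d + 1)) (∑ t ∈ Finset.Icc j (j + d), ms t) w
    rw [hsum, Finset.sum_add_distrib, ← hIoc]
    simp only [← add_assoc]
    abel

end WakimotoOperators

/-- for `1 ≤ j < i ≤ n` and `M = m_j + ⋯ + m_i`,
`[ρ(F_i)_{m_i}, [ρ(F_{i−1})_{m_{i−1}}, [⋯, ρ(F_j)_{m_j}]⋯]]
  = a_{ji,M} + Σ_{q=i+1}^n Σ_{s∈ℤ} a_{jq,s} a*_{i+1,q,M−s}`. -/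
theorem wakimoto_nested_F (n r : ℕ) (γ : ℂ) (e : ℕ → ℕ → ℂ) (lam : ℕ → ℂ)
    (hn : 1 ≤ n) (hr : r ≤ n)
    (he : ∀ i j, 1 ≤ i → i ≤ n → 1 ≤ j → j ≤ n →
      (∑ k : Fin n, e i (k.1 + 1) * e j (k.1 + 1)) = Bentry r γ i j)
    (i j : ℕ) (hj : 1 ≤ j) (hji : j < i) (hi : i ≤ n) (ms : ℕ → ℤ) :
    nestedF n r ms j (i - j) = fun w =>
      aop n r j i (∑ t ∈ Finset.Icc j i, ms t) w +
        ∑ q ∈ Finset.Icc (i + 1) n,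
          ∑ᶠ s : ℤ, aop n r j q s
            (astarop n r (i + 1) q ((∑ t ∈ Finset.Icc j i, ms t) - s) w) := by
  obtain ⟨d, rfl⟩ := Nat.exists_eq_add_of_lt hji
  funext w
  rw [show j + d + 1 - j = d + 1 by omega]
  exact nestedF_apply n r hj hi ms w
end
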